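/- arXiv:math/0407016 — 2 statements merged into one kernel-verified Lean document; each statement's English description precedes it below -/
import Mathlib

section
/- Let q ≥ 2 and for each n ≥ 2 let R_n denote the length of the standard right factor of a Lyndon word of length n over a totally ordered alphabet with q letters, with the uniform probability on the set of Lyndon words of length n. Then for every real x with 0 ≤ x < 1, the probability that R_n ≤ x·n converges, as n → ∞, to (q−1)x/q. (Equivalently, R_n/n converges in distribution to μ(dx) = (1/q)δ_1(dx) + ((q−1)/q)·1_{[0,1)}(x)dx.) -/
open scoped Classical

/-- A Lyndon word: strictly smaller, in lexicographic order, than each of its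
proper (nonempty) suffixes. -/
def IsLyndon {α : Type*} [LinearOrder α] (w : List α) : Prop :=
  ∀ i, 0 < i → i < w.length → List.Lex (· < ·) w (w.drop i)

/-- The finite set of Lyndon words of length `n` over a totally ordered alphabet
with `q` letters, encoded as functions `Fin n → Fin q`. -/
noncomputable def lyndonWords (q n : ℕ) : Finset (Fin n → Fin q) :=
  Finset.univ.filter fun w => IsLyndon (List.ofFn w)

/-- The length of the standard right factor of a word: the length of its smallest
proper suffix for the lexicographic order (the suffix `w.drop i₀` where `i₀` is the
index of the lexicographically minimal proper suffix). -/
noncomputable def srfLen {α : Type*} [LinearOrder α] (w : List α) : ℕ :=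
  w.length - sInf {i | 0 < i ∧ i < w.length ∧
    ∀ j, 0 < j → j < w.length → ¬ List.Lex (· < ·) (w.drop j) (w.drop i)}


set_option linter.all false

namespace LynAux

section

variable {n q : ℕ} [NeZero n]

/-- The periodic extension of a word. -/
def cw (w : Fin n → Fin q) (i : ℕ) : ℕ := (w (Fin.ofNat n i)).val

/-- Rotation of a word. -/
def rotw (k : ℕ) (w : Fin n → Fin q) : Fin n → Fin q := fun i => w (Fin.ofNat n (i.val + k))

lemma ofNat_eq_of_mod {i j : ℕ} (h : i % n = j % n) : Fin.ofNat n i = Fin.ofNat n j := by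
  apply Fin.ext
  simpa [Fin.ofNat] using h

lemma cw_congr (w : Fin n → Fin q) {i j : ℕ} (h : i % n = j % n) : cw w i = cw w j := by
  unfold cw
  rw [ofNat_eq_of_mod h]

lemma cw_mod (w : Fin n → Fin q) (i : ℕ) : cw w (i % n) = cw w i :=
  cw_congr w (Nat.mod_mod _ _)

lemma cw_rot (k : ℕ) (w : Fin n → Fin q) (i : ℕ) : cw (rotw k w) i = cw w (i + k) := by
  unfold cw rotw
  congr 2
  apply ofNat_eq_of_mod
  simp [Fin.ofNat]

lemma cw_val (w : Fin n → Fin q) (i : Fin n) : cw w i.val = (w i).val := by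
  unfold cw
  congr 2
  apply Fin.ext
  simp [Fin.ofNat, Nat.mod_eq_of_lt i.isLt]

lemma cw_ext {w w' : Fin n → Fin q} (h : ∀ i < n, cw w i = cw w' i) : w = w' := by
  funext i
  apply Fin.ext
  rw [← cw_val, ← cw_val]
  exact h i i.isLt

lemma rot_inj (k : ℕ) : Function.Injective (rotw (n := n) (q := q) k) := by
  intro w w' h
  apply cw_ext
  intro i _
  have hk : k ≤ k * n := Nat.le_mul_of_pos_right k (NeZero.pos n)
  have e : ∀ v : Fin n → Fin q, cw v i = cw (rotw k v) (i + (k * n - k)) := by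
    intro v
    rw [cw_rot]
    apply cw_congr
    rw [show i + (k * n - k) + k = i + k * n by omega]
    simp
  have e2 := e w'
  rw [e w, e2, h]

/-- The cyclic window of length `L` at position `i`. -/
def win (L : ℕ) (w : Fin n → Fin q) (i : ℕ) : Lex (Fin L → ℕ) := toLex fun t => cw w (i + t.val)

lemma win_congr (L : ℕ) (w : Fin n → Fin q) {i j : ℕ} (h : i % n = j % n) :
    win L w i = win L w j := by
  unfold win
  congr 1
  funext t
  apply cw_congr
  rw [Nat.add_mod, h, ← Nat.add_mod]

lemma win_rot (L k : ℕ) (w : Fin n → Fin q) (i : ℕ) :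
    win L (rotw k w) i = win L w (i + k) := by
  unfold win
  congr 1
  funext t
  rw [cw_rot]
  congr 1
  omega

lemma win_eq_iff {L : ℕ} {w w' : Fin n → Fin q} {i j : ℕ} :
    win L w i = win L w' j ↔ ∀ t < L, cw w (i + t) = cw w' (j + t) := by
  unfold win
  constructor
  · intro h t ht
    exact congrFun (toLex.injective h) ⟨t, ht⟩
  · intro h
    congr 1
    funext t
    exact h t t.isLt

lemma win_lt_iff {L : ℕ} {w : Fin n → Fin q} {i j : ℕ} :
    win L w i < win L w j ↔ ∃ k < L, (∀ t < k, cw w (i + t) = cw w (j + t)) ∧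
      cw w (i + k) < cw w (j + k) := by
  have : win L w i < win L w j ↔ ∃ k : Fin L, (∀ t : Fin L, t < k →
    cw w (i + t.val) = cw w (j + t.val)) ∧ cw w (i + k.val) < cw w (j + k.val) := Iff.rfl
  rw [this]
  constructor
  · rintro ⟨k, h1, h2⟩
    exact ⟨k, k.isLt, fun t ht => h1 ⟨t, ht.trans k.isLt⟩ ht, h2⟩
  · rintro ⟨k, hk, h1, h2⟩
    exact ⟨⟨k, hk⟩, fun t ht => h1 t ht, h2⟩

/-- All windows are distinct. -/
def Gd (L : ℕ) (w : Fin n → Fin q) : Prop :=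
  ∀ i < n, ∀ j < n, win L w i = win L w j → i = j

lemma card_determ (A : Finset (Fin n → Fin q)) (S : Finset (Fin n))
    (h : ∀ w ∈ A, ∀ w' ∈ A, (∀ i ∉ S, w i = w' i) → w = w') :
    A.card * q ^ S.card ≤ q ^ n := by
  have h1 : A.card ≤ (Finset.univ : Finset ({i // i ∉ S} → Fin q)).card := by
    apply Finset.card_le_card_of_injOn (fun w i => w i.1)
    · intro _ _; simp
    · intro w hw w' hw' e
      apply h w hw w' hw'
      intro i hi
      exact congrFun e ⟨i, hi⟩
  have h2 : (Finset.univ : Finset ({i // i ∉ S} → Fin q)).card = q ^ (n - S.card) := by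
    rw [Finset.card_univ, Fintype.card_fun, Fintype.card_fin]
    congr 1
    simp [Fintype.card_subtype_compl]
  have h3 : S.card ≤ n := by simpa using Finset.card_le_univ S
  calc A.card * q ^ S.card ≤ q ^ (n - S.card) * q ^ S.card := by
        rw [← h2]; exact Nat.mul_le_mul_right _ h1
    _ = q ^ n := by rw [← pow_add]; congr 1; omega

lemma mod_inj_of_lt {a s t : ℕ} (hs : s < n) (ht : t < n) (h : (a + s) % n = (a + t) % n) :
    s = t := by
  have h2 : s ≡ t [MOD n] := Nat.ModEq.add_left_cancel' a h
  exact Nat.ModEq.eq_of_lt_of_lt h2 hs ht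

lemma card_win_eq (L i d : ℕ) (hd : 0 < d) (hdL : d + L ≤ n) :
    (Finset.univ.filter fun w : Fin n → Fin q => win L w i = win L w (i + d)).card * q ^ L
      ≤ q ^ n := by
  set S : Finset (Fin n) := (Finset.range L).image (fun t => Fin.ofNat n (i + (d + t))) with hS
  have hc : S.card = L := by
    rw [hS, Finset.card_image_of_injOn, Finset.card_range]
    intro s hs t ht h
    simp only [Finset.coe_range, Set.mem_Iio] at hs ht
    have h' : (i + (d + s)) % n = (i + (d + t)) % n := by
      simpa [Fin.ofNat] using congrArg Fin.val h
    have := mod_inj_of_lt (by omega) (by omega) h'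
    omega
  have := card_determ (Finset.univ.filter fun w : Fin n → Fin q => win L w i = win L w (i + d)) S ?_
  · rwa [hc] at this
  intro w hw w' hw' he
  simp only [Finset.mem_filter, Finset.mem_univ, true_and, win_eq_iff] at hw hw'
  have key : ∀ s < n, cw w (i + s) = cw w' (i + s) := by
    intro s
    induction s using Nat.strong_induction_on with
    | _ s ih =>
      intro hs
      by_cases h : d ≤ s ∧ s < d + L
      · have a1 := hw (s - d) (by omega)
        have a2 := hw' (s - d) (by omega)
        rw [show i + d + (s - d) = i + s by omega] at a1 a2
        rw [← a1, ← a2]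
        exact ih (s - d) (by omega) (by omega)
      · unfold cw
        rw [he]
        rw [hS]
        simp only [Finset.mem_image, Finset.mem_range, not_exists, not_and]
        intro t ht hh
        have h' : (i + (d + t)) % n = (i + s) % n := by
          simpa [Fin.ofNat] using congrArg Fin.val hh
        have := mod_inj_of_lt (by omega) (by omega) h'
        omega
  apply rot_inj i
  apply cw_ext
  intro s hs
  rw [cw_rot, cw_rot, add_comm]
  exact key s hs

lemma card_win_eq' (L i j : ℕ) (hi : i < n) (hj : j < n) (hij : i < j) (hL : 2 * L ≤ n) :
    (Finset.univ.filter fun w : Fin n → Fin q => win L w i = win L w j).card * q ^ L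
      ≤ q ^ n := by
  by_cases h : (j - i) + L ≤ n
  · have := card_win_eq (q := q) (n := n) L i (j - i) (by omega) h
    rwa [show i + (j - i) = j by omega] at this
  · have := card_win_eq (q := q) (n := n) L j (n - (j - i)) (by omega) (by omega)
    rw [show j + (n - (j - i)) = i + n by omega] at this
    have e : (Finset.univ.filter fun w : Fin n → Fin q => win L w i = win L w j) =
        (Finset.univ.filter fun w : Fin n → Fin q => win L w j = win L w (i + n)) := by
      apply Finset.filter_congr
      intro w _
      rw [win_congr L w (i := i + n) (j := i) (by simp)]
      exact eq_comm
    rw [e]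
    exact this

lemma card_not_Gd (L : ℕ) (hL : 2 * L ≤ n) :
    (Finset.univ.filter fun w : Fin n → Fin q => ¬ Gd L w).card * q ^ L ≤ n ^ 2 * q ^ n := by
  have hsub : (Finset.univ.filter fun w : Fin n → Fin q => ¬ Gd L w) ⊆
      (((Finset.range n) ×ˢ (Finset.range n)).filter fun p => p.1 < p.2).biUnion
        fun p => Finset.univ.filter fun w : Fin n → Fin q => win L w p.1 = win L w p.2 := by
    intro w hw
    replace hw := (Finset.mem_filter.1 hw).2
    unfold Gd at hw
    push Not at hw
    obtain ⟨i, hi, j, hj, he, hne⟩ := hw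
    simp only [Finset.mem_biUnion, Finset.mem_filter, Finset.mem_product, Finset.mem_range,
      Finset.mem_univ, true_and]
    rcases lt_or_gt_of_ne hne with h | h
    · exact ⟨(i, j), ⟨⟨hi, hj⟩, h⟩, he⟩
    · exact ⟨(j, i), ⟨⟨hj, hi⟩, h⟩, he.symm⟩
  calc _ ≤ (∑ p ∈ (((Finset.range n) ×ˢ (Finset.range n)).filter fun p => p.1 < p.2),
        (Finset.univ.filter fun w : Fin n → Fin q => win L w p.1 = win L w p.2).card) * q ^ L :=
        Nat.mul_le_mul_right _ ((Finset.card_le_card hsub).trans Finset.card_biUnion_le)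
    _ ≤ ∑ p ∈ (((Finset.range n) ×ˢ (Finset.range n)).filter fun p => p.1 < p.2), q ^ n := by
        rw [Finset.sum_mul]
        apply Finset.sum_le_sum
        intro p hp
        simp only [Finset.mem_filter, Finset.mem_product, Finset.mem_range] at hp
        exact card_win_eq' L p.1 p.2 hp.1.1 hp.1.2 hp.2 hL
    _ ≤ n ^ 2 * q ^ n := by
        rw [Finset.sum_const, smul_eq_mul]
        apply Nat.mul_le_mul_right
        refine (Finset.card_filter_le _ _).trans ?_
        simp [sq]

/-- The positions of the smallest and second smallest windows. -/
def TopW (L : ℕ) (w : Fin n → Fin q) (p p' : ℕ) : Prop :=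
  p < n ∧ p' < n ∧ p ≠ p' ∧ (∀ i < n, win L w p ≤ win L w i) ∧
    (∀ i < n, i ≠ p → win L w p' ≤ win L w i)

lemma exists_top (L : ℕ) (w : Fin n → Fin q) (hn : 2 ≤ n) : ∃ p : ℕ × ℕ, TopW L w p.1 p.2 := by
  obtain ⟨p, hp, h1⟩ := Finset.exists_min_image (Finset.range n) (win L w) ⟨0, by simp; omega⟩
  obtain ⟨p', hp', h2⟩ := Finset.exists_min_image ((Finset.range n).erase p) (win L w) (by
    by_cases h : p = 0
    · exact ⟨1, by simp; omega⟩
    · exact ⟨0, by simp; omega⟩)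
  simp only [Finset.mem_erase, Finset.mem_range] at *
  exact ⟨(p, p'), hp, hp'.2, fun h => hp'.1 h.symm, h1, fun i hi hne => h2 i ⟨hne, hi⟩⟩

lemma topW_unique {L : ℕ} {w : Fin n → Fin q} (hG : Gd L w) {p p' r r' : ℕ}
    (h : TopW L w p p') (h' : TopW L w r r') : p = r ∧ p' = r' := by
  obtain ⟨a1, a2, a3, a4, a5⟩ := h
  obtain ⟨b1, b2, b3, b4, b5⟩ := h'
  have e : p = r := hG p a1 r b1 (le_antisymm (a4 r b1) (b4 p a1))
  subst e
  exact ⟨rfl, hG p' a2 r' b2 (le_antisymm (a5 r' b2 (Ne.symm b3)) (b5 p' a2 (Ne.symm a3)))⟩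

/-- position of the minimal and second minimal window -/
noncomputable def tp (L : ℕ) (w : Fin n → Fin q) : ℕ × ℕ :=
  if h : ∃ p : ℕ × ℕ, TopW L w p.1 p.2 then h.choose else (0, 0)

lemma tp_spec (L : ℕ) (w : Fin n → Fin q) (hn : 2 ≤ n) : TopW L w (tp L w).1 (tp L w).2 := by
  unfold tp
  rw [dif_pos (exists_top L w hn)]
  exact (exists_top L w hn).choose_spec

lemma tp_eq {L : ℕ} {w : Fin n → Fin q} (hn : 2 ≤ n) (hG : Gd L w) {p p' : ℕ}
    (h : TopW L w p p') : (tp L w).1 = p ∧ (tp L w).2 = p' :=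
  topW_unique hG (tp_spec L w hn) h

lemma sub_mod_add {p k : ℕ} (hk : k < n) : ((p + n - k) % n + k) % n = p % n := by
  rw [Nat.mod_add_mod, show p + n - k + k = p + n by omega, Nat.add_mod_right]

lemma sub_mod_inj {p p' k : ℕ} (hp : p < n) (hp' : p' < n) (hk : k < n)
    (h : (p + n - k) % n = (p' + n - k) % n) : p = p' := by
  have := sub_mod_add (n := n) (p := p) hk
  rw [h, sub_mod_add hk, Nat.mod_eq_of_lt hp, Nat.mod_eq_of_lt hp'] at this
  exact this.symm

lemma Gd_rot {L k : ℕ} {w : Fin n → Fin q} (hG : Gd L w) : Gd L (rotw k w) := by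
  intro i hi j hj h
  rw [win_rot, win_rot, win_congr L w (Nat.mod_mod (i + k) n).symm,
    win_congr L w (Nat.mod_mod (j + k) n).symm] at h
  have := hG _ (Nat.mod_lt _ (NeZero.pos n)) _ (Nat.mod_lt _ (NeZero.pos n)) h
  rw [add_comm i, add_comm j] at this
  exact mod_inj_of_lt hi hj this

lemma rot_n (w : Fin n → Fin q) : rotw n w = w := by
  apply cw_ext
  intro i _
  rw [cw_rot]
  exact cw_congr w (by simp)

lemma rot_rot (j k : ℕ) (w : Fin n → Fin q) : rotw j (rotw k w) = rotw (j + k) w := by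
  apply cw_ext
  intro i _
  rw [cw_rot, cw_rot, cw_rot, add_assoc]

lemma Top_rot {L k : ℕ} (hk : k < n) {w : Fin n → Fin q} {p p' : ℕ} (h : TopW L w p p') :
    TopW L (rotw k w) ((p + n - k) % n) ((p' + n - k) % n) := by
  obtain ⟨a1, a2, a3, a4, a5⟩ := h
  have hn := NeZero.pos n
  refine ⟨Nat.mod_lt _ hn, Nat.mod_lt _ hn, fun h => a3 (sub_mod_inj a1 a2 hk h), ?_, ?_⟩
  · intro i hi
    rw [win_rot, win_rot, win_congr L w (sub_mod_add hk),
      win_congr L w (Nat.mod_mod (i + k) n).symm]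
    exact a4 _ (Nat.mod_lt _ hn)
  · intro i hi hne
    rw [win_rot, win_rot, win_congr L w (sub_mod_add hk),
      win_congr L w (Nat.mod_mod (i + k) n).symm]
    refine a5 _ (Nat.mod_lt _ hn) ?_
    intro he
    apply hne
    have : (i + k) % n = ((p + n - k) % n + k) % n := by
      rw [sub_mod_add hk, he, Nat.mod_eq_of_lt a1]
    rw [add_comm, add_comm _ k] at this
    exact mod_inj_of_lt hi (Nat.mod_lt _ hn) this

lemma tp_rot {L k : ℕ} (hn : 2 ≤ n) (hk : k < n) {w : Fin n → Fin q} (hG : Gd L w) :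
    (tp L (rotw k w)).1 = ((tp L w).1 + n - k) % n ∧
    (tp L (rotw k w)).2 = ((tp L w).2 + n - k) % n :=
  tp_eq hn (Gd_rot hG) (Top_rot hk (tp_spec L w hn))

lemma card_family (A : ℕ → Finset (Fin n → Fin q))
    (h : ∀ i < n, ∀ k < n, ∀ w ∈ A i, rotw k w ∈ A ((i + n - k) % n)) :
    ∀ i < n, (A i).card = (A 0).card := by
  intro i hi
  apply le_antisymm
  · apply Finset.card_le_card_of_injOn (rotw i)
    · intro w hw
      have := h i hi i hi w hw
      rwa [show i + n - i = n by omega, Nat.mod_self] at this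
    · exact (rot_inj i).injOn
  · rcases Nat.eq_zero_or_pos i with h0 | h0
    · subst h0; exact le_rfl
    apply Finset.card_le_card_of_injOn (rotw (n - i))
    · intro w hw
      have := h 0 (NeZero.pos n) (n - i) (by omega) w hw
      rwa [show 0 + n - (n - i) = i by omega, Nat.mod_eq_of_lt hi] at this
    · exact (rot_inj _).injOn

/-- The cyclic distance from the minimal to the second minimal window. -/
noncomputable def Dd (L : ℕ) (w : Fin n → Fin q) : ℕ := ((tp L w).2 + n - (tp L w).1) % n

lemma Dd_rot {L k : ℕ} (hn : 2 ≤ n) (hk : k < n) {w : Fin n → Fin q} (hG : Gd L w) :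
    Dd L (rotw k w) = Dd L w := by
  obtain ⟨e1, e2⟩ := tp_rot hn hk hG
  have ht := tp_spec L w hn
  have ht' := tp_spec L (rotw k w) hn
  unfold Dd
  have a := sub_mod_add (n := n) (p := (tp L (rotw k w)).2) (k := (tp L (rotw k w)).1) ht'.1
  have b := sub_mod_add (n := n) (p := (tp L w).2) (k := (tp L w).1) ht.1
  have hp1 := sub_mod_add (n := n) (p := (tp L w).1) hk
  have hp2 := sub_mod_add (n := n) (p := (tp L w).2) hk
  rw [← e1] at hp1
  rw [← e2] at hp2
  set d := ((tp L (rotw k w)).2 + n - (tp L (rotw k w)).1) % n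
  set d' := ((tp L w).2 + n - (tp L w).1) % n
  have hd : d < n := Nat.mod_lt _ (NeZero.pos n)
  have hd' : d' < n := Nat.mod_lt _ (NeZero.pos n)
  apply mod_inj_of_lt (a := (tp L w).1) hd hd'
  calc ((tp L w).1 + d) % n = ((tp L (rotw k w)).1 + k + d) % n := by
        rw [Nat.add_mod, ← hp1, ← Nat.add_mod]
    _ = ((d + (tp L (rotw k w)).1) + k) % n := by congr 1; omega
    _ = ((tp L (rotw k w)).2 + k) % n := by rw [Nat.add_mod, a, ← Nat.add_mod]
    _ = (tp L w).2 % n := hp2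
    _ = _ := by rw [← b, add_comm]

lemma card_by_p1 (L : ℕ) (hn : 2 ≤ n) (P : ℕ → Prop) (i : ℕ) (hi : i < n) :
    (Finset.univ.filter fun w : Fin n → Fin q => Gd L w ∧ (tp L w).1 = i ∧ P (Dd L w)).card =
    (Finset.univ.filter fun w : Fin n → Fin q => Gd L w ∧ (tp L w).1 = 0 ∧ P (Dd L w)).card := by
  refine card_family (fun i => Finset.univ.filter fun w : Fin n → Fin q =>
    Gd L w ∧ (tp L w).1 = i ∧ P (Dd L w)) ?_ i hi
  intro i hi k hk w hw
  simp only [Finset.mem_filter, Finset.mem_univ, true_and] at hw ⊢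
  exact ⟨Gd_rot hw.1, by rw [(tp_rot hn hk hw.1).1, hw.2.1], by
    rw [Dd_rot hn hk hw.1]; exact hw.2.2⟩

lemma card_by_p2 (L : ℕ) (hn : 2 ≤ n) (i : ℕ) (hi : i < n) :
    (Finset.univ.filter fun w : Fin n → Fin q => Gd L w ∧ (tp L w).2 = i).card =
    (Finset.univ.filter fun w : Fin n → Fin q => Gd L w ∧ (tp L w).2 = 0).card := by
  refine card_family (fun i => Finset.univ.filter fun w : Fin n → Fin q =>
    Gd L w ∧ (tp L w).2 = i) ?_ i hi
  intro i hi k hk w hw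
  simp only [Finset.mem_filter, Finset.mem_univ, true_and] at hw ⊢
  exact ⟨Gd_rot hw.1, by rw [(tp_rot hn hk hw.1).2, hw.2]⟩

lemma card_D (L : ℕ) (hn : 2 ≤ n) (P : ℕ → Prop) :
    (Finset.univ.filter fun w : Fin n → Fin q => Gd L w ∧ P (Dd L w)).card =
    n * (Finset.univ.filter fun w : Fin n → Fin q =>
      Gd L w ∧ (tp L w).1 = 0 ∧ P (tp L w).2).card := by
  rw [Finset.card_eq_sum_card_fiberwise (f := fun w => (tp L w).1) (t := Finset.range n)]
  · rw [Finset.sum_congr rfl (g := fun _ => (Finset.univ.filter fun w : Fin n → Fin q =>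
      Gd L w ∧ (tp L w).1 = 0 ∧ P (tp L w).2).card)]
    · simp
    intro i hi
    rw [Finset.filter_filter]
    have := card_by_p1 (q := q) L hn P i (by simpa using hi)
    convert this using 2
    · ext w; simp; tauto
    · ext w
      simp only [Finset.mem_filter, Finset.mem_univ, true_and]
      have ht := tp_spec L w hn
      constructor
      · rintro ⟨a, b, c⟩
        refine ⟨a, b, ?_⟩
        unfold Dd
        rwa [b, Nat.sub_zero, Nat.add_mod_right, Nat.mod_eq_of_lt ht.2.1]
      · rintro ⟨a, b, c⟩
        refine ⟨a, b, ?_⟩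
        unfold Dd at c
        rwa [b, Nat.sub_zero, Nat.add_mod_right, Nat.mod_eq_of_lt ht.2.1] at c
  · intro w _
    simpa using (tp_spec L w hn).1

/-- positions in `S` are rare for p1 and p2 -/
lemma card_p1_mem (L : ℕ) (hn : 2 ≤ n) (S : Finset ℕ) (hS : S ⊆ Finset.range n) :
    n * (Finset.univ.filter fun w : Fin n → Fin q => Gd L w ∧ (tp L w).1 ∈ S).card ≤
      S.card * q ^ n := by
  have key : ∀ T ⊆ Finset.range n,
      (Finset.univ.filter fun w : Fin n → Fin q => Gd L w ∧ (tp L w).1 ∈ T).card = T.card *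
      (Finset.univ.filter fun w : Fin n → Fin q => Gd L w ∧ (tp L w).1 = 0).card := by
    intro T hT
    rw [Finset.card_eq_sum_card_fiberwise (f := fun w => (tp L w).1) (t := T)]
    · rw [Finset.sum_congr rfl (g := fun _ => (Finset.univ.filter fun w : Fin n → Fin q =>
        Gd L w ∧ (tp L w).1 = 0).card)]
      · simp
      intro i hi
      rw [Finset.filter_filter]
      have := card_by_p1 (q := q) L hn (fun _ => True) i (by simpa using hT hi)
      simp only [and_true] at this
      rw [← this]
      congr 1
      ext w
      simp
      grind
    · intro w hw
      simp at hw
      exact hw.2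
  rw [key S hS]
  have h2 := key _ (Finset.Subset.refl (Finset.range n))
  rw [Finset.card_range] at h2
  calc _ = S.card * (n * (Finset.univ.filter fun w : Fin n → Fin q =>
        Gd L w ∧ (tp L w).1 = 0).card) := by ring
    _ ≤ _ := by
      rw [← h2]
      apply Nat.mul_le_mul_left
      refine (Finset.card_le_univ _).trans ?_
      simp

lemma card_p2_mem (L : ℕ) (hn : 2 ≤ n) (S : Finset ℕ) (hS : S ⊆ Finset.range n) :
    n * (Finset.univ.filter fun w : Fin n → Fin q => Gd L w ∧ (tp L w).2 ∈ S).card ≤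
      S.card * q ^ n := by
  have key : ∀ T ⊆ Finset.range n,
      (Finset.univ.filter fun w : Fin n → Fin q => Gd L w ∧ (tp L w).2 ∈ T).card = T.card *
      (Finset.univ.filter fun w : Fin n → Fin q => Gd L w ∧ (tp L w).2 = 0).card := by
    intro T hT
    rw [Finset.card_eq_sum_card_fiberwise (f := fun w => (tp L w).2) (t := T)]
    · rw [Finset.sum_congr rfl (g := fun _ => (Finset.univ.filter fun w : Fin n → Fin q =>
        Gd L w ∧ (tp L w).2 = 0).card)]
      · simp
      intro i hi
      rw [Finset.filter_filter]
      have := card_by_p2 (q := q) L hn i (by simpa using hT hi)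
      rw [← this]
      congr 1
      ext w
      simp
      grind
    · intro w hw
      simp at hw
      exact hw.2
  rw [key S hS]
  have h2 := key _ (Finset.Subset.refl (Finset.range n))
  rw [Finset.card_range] at h2
  calc _ = S.card * (n * (Finset.univ.filter fun w : Fin n → Fin q =>
        Gd L w ∧ (tp L w).2 = 0).card) := by ring
    _ ≤ _ := by
      rw [← h2]
      apply Nat.mul_le_mul_left
      refine (Finset.card_le_univ _).trans ?_
      simp

end

end LynAux

namespace LynAux

section

variable {n q : ℕ} [NeZero n]
lemma lex_drop_iff (w : Fin n → Fin q) {i j : ℕ} (hi : i < n) (hj : j < n) :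
    List.Lex (· < ·) ((List.ofFn w).drop i) ((List.ofFn w).drop j) ↔
      (∃ k, i + k < n ∧ j + k < n ∧ (∀ t < k, cw w (i+t) = cw w (j+t)) ∧
        cw w (i+k) < cw w (j+k)) ∨ (j < i ∧ ∀ t < n - i, cw w (i+t) = cw w (j+t)) := by
  have h0 : List.Lex (· < ·) ((List.ofFn w).drop i) ((List.ofFn w).drop j) ↔
    (List.ofFn w).drop i < (List.ofFn w).drop j := Iff.rfl
  rw [h0, List.lt_iff_exists, or_comm]
  have hv : ∀ (s : ℕ) (hs : s < n), (w ⟨s, hs⟩).val = cw w s := fun s hs => (cw_val w ⟨s, hs⟩).symm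
  apply or_congr
  · constructor
    · rintro ⟨k, h1, h2, h3, h4⟩
      simp only [List.length_drop, List.length_ofFn] at h1 h2
      refine ⟨k, by omega, by omega, ?_, ?_⟩
      · intro t ht
        have := congrArg Fin.val (h3 t ht)
        simpa [hv] using this
      · have : (_ : ℕ) < _ := h4
        simpa [hv] using this
    · rintro ⟨k, h1, h2, h3, h4⟩
      refine ⟨k, by simp; omega, by simp; omega, ?_, ?_⟩
      · intro t ht
        apply Fin.ext
        simpa [hv] using h3 t ht
      · show (_ : ℕ) < _
        simpa [hv] using h4
  · simp only [List.length_drop, List.length_ofFn]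
    constructor
    · rintro ⟨h1, h2⟩
      refine ⟨by omega, fun t ht => ?_⟩
      have h3 := List.ext_getElem_iff.1 h1
      have := congrArg Fin.val (h3.2 t (by simp; omega) (by simp; omega))
      simpa [hv] using this
    · rintro ⟨h1, h2⟩
      refine ⟨?_, by omega⟩
      apply List.ext_getElem
      · simp; omega
      · intro t h3 h4
        simp at h3 h4
        apply Fin.ext
        simpa [hv] using h2 t (by omega)

/-- Function form of Lyndon words. -/
def LynF (w : Fin n → Fin q) : Prop :=
  ∀ i, 0 < i → i < n → ∃ k, i + k < n ∧ (∀ t < k, cw w t = cw w (i + t)) ∧ cw w k < cw w (i + k)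

lemma lyndon_iff (w : Fin n → Fin q) : IsLyndon (List.ofFn w) ↔ LynF w := by
  unfold IsLyndon LynF
  simp only [List.length_ofFn]
  refine forall_congr' fun i => forall_congr' fun h0 => forall_congr' fun hi => ?_
  have := lex_drop_iff w (i := 0) (j := i) (NeZero.pos n) hi
  rw [List.drop_zero] at this
  rw [this]
  constructor
  · rintro (⟨k, h1, h2, h3, h4⟩ | ⟨h, _⟩)
    · refine ⟨k, h2, ?_, ?_⟩
      · simpa using h3
      · simpa using h4
    · omega
  · rintro ⟨k, h2, h3, h4⟩
    exact Or.inl ⟨k, by omega, h2, by simpa using h3, by simpa using h4⟩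

lemma cw_shift (w : Fin n → Fin q) (i : ℕ) : cw w (i + n) = cw w i := cw_congr w (by simp)

lemma Gd_win_lt {L : ℕ} {w : Fin n → Fin q} (hG : Gd L w) {i j : ℕ} (hi : i < n) (hj : j < n)
    (hne : i ≠ j) (h : win L w i ≤ win L w j) : win L w i < win L w j :=
  lt_of_le_of_ne h fun e => hne (hG i hi j hj e)

lemma lynF_of_p1 {L : ℕ} {w : Fin n → Fin q} (hn : 2 ≤ n) (hG : Gd L w) (h0 : (tp L w).1 = 0) :
    LynF w := by
  have ht := tp_spec L w hn
  rw [h0] at ht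
  have hmin := ht.2.2.2.1
  intro i hi0 hi
  obtain ⟨k, hk, h1, h2⟩ := win_lt_iff.1 (Gd_win_lt hG (NeZero.pos n) hi hi0.ne (hmin i hi))
  simp only [zero_add] at h1 h2
  refine ⟨k, ?_, h1, h2⟩
  by_contra hc
  have : win L w (n - i) < win L w 0 := by
    rw [win_lt_iff]
    refine ⟨k - (n - i), by omega, ?_, ?_⟩
    · intro t ht
      rw [h1 _ (by omega), show i + (n - i + t) = (0 + t) + n by omega, cw_shift]
    · rw [show n - i + (k - (n - i)) = k by omega]
      refine h2.trans_eq ?_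
      rw [show i + k = (0 + (k - (n - i))) + n by omega, cw_shift]
  exact absurd (hmin (n - i) (by omega)) (not_le.2 this)

lemma win_le_of {L : ℕ} {w : Fin n → Fin q} {i j k : ℕ}
    (h1 : ∀ t < k, cw w (i + t) = cw w (j + t)) (h2 : cw w (i + k) < cw w (j + k)) :
    win L w i ≤ win L w j := by
  by_cases h : k < L
  · exact (win_lt_iff.2 ⟨k, h, h1, h2⟩).le
  · exact (win_eq_iff.2 fun t ht => h1 t (by omega)).le

lemma p1_of_lynF {L : ℕ} {w : Fin n → Fin q} (hn : 2 ≤ n) (hG : Gd L w) (h : LynF w) :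
    (tp L w).1 = 0 := by
  have ht := tp_spec L w hn
  by_contra hne
  obtain ⟨k, h1, h2, h3⟩ := h _ (Nat.pos_of_ne_zero hne) ht.1
  refine hne (hG _ ht.1 0 (NeZero.pos n) (le_antisymm (ht.2.2.2.1 0 (NeZero.pos n)) ?_))
  exact win_le_of (k := k) (by simpa using h2) (by simpa using h3)

lemma lex_of_win_lt {L : ℕ} {w : Fin n → Fin q} (hn : 2 ≤ n) (h0 : (tp L w).1 = 0)
    {i j : ℕ} (hi0 : 0 < i) (hi : i < n) (hj : j < n) (h : win L w i < win L w j) :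
    List.Lex (· < ·) ((List.ofFn w).drop i) ((List.ofFn w).drop j) := by
  have ht := tp_spec L w hn
  rw [h0] at ht
  have hmin := ht.2.2.2.1
  rw [lex_drop_iff w hi hj]
  obtain ⟨k, hk, h1, h2⟩ := win_lt_iff.1 h
  by_cases a : i + k < n ∧ j + k < n
  · exact Or.inl ⟨k, a.1, a.2, h1, h2⟩
  have hij : i ≠ j := by rintro rfl; exact absurd h (lt_irrefl _)
  rcases lt_or_gt_of_ne hij with hlt | hgt
  · exfalso
    have : win L w (i + n - j) < win L w 0 := by
      rw [win_lt_iff]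
      refine ⟨k - (n - j), by omega, ?_, ?_⟩
      · intro t ht
        rw [show i + n - j + t = i + (n - j + t) by omega, h1 _ (by omega),
          show j + (n - j + t) = (0 + t) + n by omega, cw_shift]
      · rw [show i + n - j + (k - (n - j)) = i + k by omega]
        refine h2.trans_eq ?_
        rw [show j + k = (0 + (k - (n - j))) + n by omega, cw_shift]
    exact absurd (hmin (i + n - j) (by omega)) (not_le.2 this)
  · exact Or.inr ⟨hgt, fun t ht => h1 t (by omega)⟩

lemma srf_eq {L : ℕ} {w : Fin n → Fin q} (hn : 2 ≤ n) (hG : Gd L w) (h0 : (tp L w).1 = 0) :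
    srfLen (List.ofFn w) = n - (tp L w).2 := by
  have ht := tp_spec L w hn
  rw [h0] at ht
  obtain ⟨-, h2, h3, h4, h5⟩ := ht
  have hpos : 0 < (tp L w).2 := Nat.pos_of_ne_zero (Ne.symm h3)
  have key : ∀ j, 0 < j → j < n → j ≠ (tp L w).2 →
      List.Lex (· < ·) ((List.ofFn w).drop (tp L w).2) ((List.ofFn w).drop j) := by
    intro j hj0 hj hne
    exact lex_of_win_lt hn h0 hpos h2 hj (Gd_win_lt hG h2 hj hne.symm (h5 j hj hj0.ne'))
  have hset : {i | 0 < i ∧ i < (List.ofFn w).length ∧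
      ∀ j, 0 < j → j < (List.ofFn w).length →
        ¬ List.Lex (· < ·) ((List.ofFn w).drop j) ((List.ofFn w).drop i)} = {(tp L w).2} := by
    ext i
    simp only [List.length_ofFn, Set.mem_setOf_eq, Set.mem_singleton_iff]
    constructor
    · rintro ⟨hi0, hi, hall⟩
      by_contra hne
      exact hall _ hpos h2 (key i hi0 hi hne)
    · rintro rfl
      refine ⟨hpos, h2, fun j hj0 hj hlex => ?_⟩
      have hl : (List.ofFn w).drop j < (List.ofFn w).drop (tp L w).2 := hlex
      by_cases e : j = (tp L w).2
      · rw [e] at hl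
        exact lt_irrefl _ hl
      · exact lt_asymm hl (key j hj0 hj e)
  unfold srfLen
  rw [hset, List.length_ofFn, csInf_singleton]

lemma lynF_rot_false {w : Fin n → Fin q} {d : ℕ} (h : LynF w) (h' : LynF (rotw d w))
    (hd0 : 0 < d) (hd : d < n) : False := by
  obtain ⟨k, a1, a2, a3⟩ := h d hd0 hd
  obtain ⟨k', b1, b2, b3⟩ := h' (n - d) (by omega) (by omega)
  simp only [cw_rot] at b2 b3
  have e : ∀ t, cw w (n - d + t + d) = cw w t := by
    intro t
    rw [show n - d + t + d = t + n by omega, cw_shift]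
  rw [e] at b3
  have b2' : ∀ t < k', cw w (t + d) = cw w t := fun t ht => by rw [b2 t ht, e]
  rw [add_comm] at b3
  rcases lt_trichotomy k k' with h | h | h
  · have := b2' k h
    rw [add_comm] at this
    omega
  · subst h; omega
  · have := a2 k' h
    omega

lemma card_lyn_inv (P : (Fin n → Fin q) → Prop) (hP : ∀ w k, P w → P (rotw k w)) :
    n * (Finset.univ.filter fun w : Fin n → Fin q => LynF w ∧ P w).card ≤
      (Finset.univ.filter fun w : Fin n → Fin q => P w).card := by
  have : ((Finset.range n) ×ˢ (Finset.univ.filter fun w : Fin n → Fin q => LynF w ∧ P w)).card ≤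
      (Finset.univ.filter fun w : Fin n → Fin q => P w).card := by
    apply Finset.card_le_card_of_injOn (fun p => rotw p.1 p.2)
    · rintro ⟨k, w⟩ h
      simp at h ⊢
      exact hP w k h.2.2
    · have key : ∀ k k' : ℕ, ∀ w w' : Fin n → Fin q, k < n → k' < n → LynF w → LynF w' → k < k' →
          rotw k w = rotw k' w' → False := by
        intro k k' w w' hk hk' hw hw' hlt he
        rw [show k' = k + (k' - k) by omega, ← rot_rot] at he
        have := rot_inj k he
        rw [this] at hw
        exact lynF_rot_false hw' hw (by omega) (by omega)
      rintro ⟨k, w⟩ h ⟨k', w'⟩ h' he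
      simp at h h' he
      rcases lt_trichotomy k k' with hh | hh | hh
      · exact (key k k' w w' h.1 h'.1 h.2.1 h'.2.1 hh he).elim
      · subst hh
        rw [rot_inj k he]
      · exact (key k' k w' w h'.1 h.1 h'.2.1 h.2.1 hh he.symm).elim
  simpa using this

lemma not_Gd_rot {L : ℕ} (w : Fin n → Fin q) (k : ℕ) (h : ¬ Gd L w) : ¬ Gd L (rotw k w) := by
  intro hG
  apply h
  have hk : k ≤ k * n := Nat.le_mul_of_pos_right k (NeZero.pos n)
  have := Gd_rot (k := k * n - k) hG
  rw [rot_rot, show k * n - k + k = k * n by omega] at this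
  have e : rotw (k * n) w = w := by
    apply cw_ext
    intro i _
    rw [cw_rot]
    exact cw_congr w (by simp)
  rwa [e] at this

lemma card_lyn_notG (L : ℕ) :
    n * (Finset.univ.filter fun w : Fin n → Fin q => LynF w ∧ ¬ Gd L w).card ≤
      (Finset.univ.filter fun w : Fin n → Fin q => ¬ Gd L w).card :=
  by convert card_lyn_inv (n := n) (q := q) (fun w => ¬ Gd L w) (fun w k h => not_Gd_rot w k h)

lemma card_lyn_nozero :
    n * (Finset.univ.filter fun w : Fin n → Fin q => LynF w ∧ ∀ i, cw w i ≠ 0).card ≤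
      (Finset.univ.filter fun w : Fin n → Fin q => ∀ i, cw w i ≠ 0).card :=
  card_lyn_inv _ (fun w k h i => by rw [cw_rot]; exact h _)

end

section

variable {N q : ℕ} [NeZero N]

lemma cw_tail (w : Fin (N + 1) → Fin q) {i : ℕ} (hi : i < N) :
    cw (Fin.tail w) i = cw w (1 + i) := by
  have h1 := cw_val (Fin.tail w) ⟨i, hi⟩
  have h2 := cw_val w ⟨i + 1, by omega⟩
  simp only at h1 h2
  rw [h1, add_comm 1 i, h2]
  rfl

lemma lynF_tail (w : Fin (N + 1) → Fin q) (hN : 2 ≤ N) (h0 : cw w 0 = 0)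
    (hu : LynF (Fin.tail w)) : LynF w := by
  have hu' : ∀ i, 1 < i → i < N + 1 → ∃ k, i + k < N + 1 ∧
      (∀ t < k, cw w (1 + t) = cw w (i + t)) ∧ cw w (1 + k) < cw w (i + k) := by
    intro i h1 h2
    obtain ⟨k, a1, a2, a3⟩ := hu (i - 1) (by omega) (by omega)
    refine ⟨k, by omega, ?_, ?_⟩
    · intro t ht
      have := a2 t ht
      rwa [cw_tail w (by omega), cw_tail w (by omega),
        show 1 + (i - 1 + t) = i + t by omega] at this
    · rwa [cw_tail w (by omega), cw_tail w (by omega),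
        show 1 + (i - 1 + k) = i + k by omega] at a3
  have hex : ∃ k, 1 + k < N + 1 ∧ cw w (1 + k) ≠ 0 := by
    obtain ⟨k, a1, a2, a3⟩ := hu' 2 (by omega) (by omega)
    exact ⟨1 + k, by omega, by rw [show 1 + (1 + k) = 2 + k by omega]; omega⟩
  classical
  have hk0 := Nat.find_spec hex
  have hkm : ∀ t < Nat.find hex, cw w (1 + t) = 0 := by
    intro t ht
    have := Nat.find_min hex ht
    by_contra hne
    exact this ⟨by omega, hne⟩
  set k0 := Nat.find hex
  have hz : ∀ t ≤ k0, cw w t = 0 := by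
    intro t ht
    rcases Nat.eq_zero_or_pos t with h | h
    · rw [h, h0]
    · have := hkm (t - 1) (by omega)
      rwa [show 1 + (t - 1) = t by omega] at this
  have main : ∀ i, (∃ k, k ≤ k0 ∧ i + k < N + 1 ∧ cw w (i + k) ≠ 0) →
      ∃ k, i + k < N + 1 ∧ (∀ t < k, cw w t = cw w (i + t)) ∧ cw w k < cw w (i + k) := by
    intro i hi
    obtain ⟨b1, b2, b3⟩ := Nat.find_spec hi
    refine ⟨Nat.find hi, b2, ?_, ?_⟩
    · intro t ht
      have := Nat.find_min hi ht
      rw [hz t (by omega)]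
      by_contra hne
      exact this ⟨by omega, by omega, fun h => hne h.symm⟩
    · rw [hz _ b1]
      omega
  intro i hi0 hi
  apply main
  rcases Nat.lt_or_ge 1 i with h1 | h1
  · obtain ⟨k, a1, a2, a3⟩ := hu' i h1 hi
    rcases Nat.lt_or_ge k0 k with h | h
    · exact ⟨k0, le_rfl, by omega, by rw [← a2 k0 h]; exact hk0.2⟩
    · exact ⟨k, h, a1, by omega⟩
  · have : i = 1 := by omega
    subst this
    exact ⟨k0, le_rfl, hk0⟩

lemma tail_lynF {L : ℕ} (w : Fin (N + 1) → Fin q) (hN : 2 ≤ N) (hG : Gd L w)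
    (h1 : (tp L w).1 = 0) (h2 : (tp L w).2 = 1) : LynF (Fin.tail w) := by
  intro i hi0 hi
  have ht := tp_spec L w (by omega)
  rw [h1, h2] at ht
  have := lex_of_win_lt (L := L) (w := w) (by omega) h1 (i := 1) (j := i + 1) (by omega) (by omega)
    (by omega) (Gd_win_lt hG (by omega) (by omega) (by omega)
      (ht.2.2.2.2 (i + 1) (by omega) (by omega)))
  rw [lex_drop_iff w (by omega) (by omega)] at this
  rcases this with ⟨k, b1, b2, b3, b4⟩ | ⟨h, _⟩
  · refine ⟨k, by omega, ?_, ?_⟩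
    · intro t ht
      rw [cw_tail w (by omega), cw_tail w (by omega), b3 t ht]
      congr 1; omega
    · rw [cw_tail w (by omega), cw_tail w (by omega)]
      rwa [show i + 1 + k = 1 + (i + k) by omega] at b4
  · omega

lemma tp_of_tail {L : ℕ} (w : Fin (N + 1) → Fin q) (hN : 2 ≤ N) (hG : Gd L w)
    (h0 : cw w 0 = 0) (hu : LynF (Fin.tail w)) : (tp L w).1 = 0 ∧ (tp L w).2 = 1 := by
  have hl := lynF_tail w hN h0 hu
  have hp := p1_of_lynF (L := L) (by omega) hG hl
  have ht := tp_spec L w (by omega)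
  rw [hp] at ht
  apply tp_eq (by omega) hG
  refine ⟨by omega, by omega, by omega, ht.2.2.2.1, ?_⟩
  intro i hi hi0
  rcases Nat.lt_or_ge 1 i with h1 | h1
  · obtain ⟨k, a1, a2, a3⟩ := hu (i - 1) (by omega) (by omega)
    apply win_le_of (k := k)
    · intro t ht
      have := a2 t ht
      rwa [cw_tail w (by omega), cw_tail w (by omega),
        show 1 + (i - 1 + t) = i + t by omega] at this
    · rwa [cw_tail w (by omega), cw_tail w (by omega),
        show 1 + (i - 1 + k) = i + k by omega] at a3
  · rw [show i = 1 by omega]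

lemma card_adj_le {L : ℕ} (hL : 1 ≤ L) (hN : 2 ≤ N) :
    (Finset.univ.filter fun w : Fin (N + 1) → Fin q =>
      Gd L w ∧ (tp L w).1 = 0 ∧ (tp L w).2 = 1).card ≤
    (Finset.univ.filter fun u : Fin N → Fin q => LynF u).card +
    (Finset.univ.filter fun w : Fin (N + 1) → Fin q => LynF w ∧ ∀ i, cw w i ≠ 0).card := by
  have hsub : (Finset.univ.filter fun w : Fin (N + 1) → Fin q =>
      Gd L w ∧ (tp L w).1 = 0 ∧ (tp L w).2 = 1) ⊆
      (Finset.univ.filter fun w : Fin (N + 1) → Fin q => cw w 0 = 0 ∧ LynF (Fin.tail w)) ∪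
      (Finset.univ.filter fun w : Fin (N + 1) → Fin q => LynF w ∧ ∀ i, cw w i ≠ 0) := by
    intro w hw
    simp only [Finset.mem_filter, Finset.mem_univ, true_and, Finset.mem_union] at hw ⊢
    obtain ⟨hG, h1, h2⟩ := hw
    by_cases hz : ∀ i, cw w i ≠ 0
    · exact Or.inr ⟨lynF_of_p1 (by omega) hG h1, hz⟩
    · left
      refine ⟨?_, tail_lynF w hN hG h1 h2⟩
      push Not at hz
      obtain ⟨i, hi⟩ := hz
      by_contra hne
      have ht := tp_spec L w (by omega)
      rw [h1] at ht
      have hle := ht.2.2.2.1 (i % (N + 1)) (Nat.mod_lt _ (by omega))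
      refine absurd hle (not_le.2 (win_lt_iff.2 ⟨0, hL, by simp, ?_⟩))
      simp only [add_zero]
      rw [cw_mod, hi]
      omega
  refine (Finset.card_le_card hsub).trans ((Finset.card_union_le _ _).trans ?_)
  apply Nat.add_le_add_right
  apply Finset.card_le_card_of_injOn Fin.tail
  · intro w hw
    simp at hw ⊢
    exact hw.2
  · intro w hw w' hw' he
    simp only [Finset.coe_filter, Finset.mem_univ, true_and, Set.mem_setOf_eq] at hw hw'
    have : w 0 = w' 0 := by
      apply Fin.ext
      rw [← cw_val, ← cw_val]
      simpa using hw.1.trans hw'.1.symm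
    rw [← Fin.cons_self_tail w, ← Fin.cons_self_tail w', he, this]

lemma card_adj_ge {L : ℕ} (hq : 0 < q) (hN : 2 ≤ N) :
    (Finset.univ.filter fun u : Fin N → Fin q => LynF u).card ≤
    (Finset.univ.filter fun w : Fin (N + 1) → Fin q =>
      Gd L w ∧ (tp L w).1 = 0 ∧ (tp L w).2 = 1).card +
    (Finset.univ.filter fun w : Fin (N + 1) → Fin q => LynF w ∧ ¬ Gd L w).card := by
  refine le_trans ?_ (Finset.card_union_le _ _)
  apply Finset.card_le_card_of_injOn (fun u : Fin N → Fin q =>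
    (Fin.cons (⟨0, hq⟩ : Fin q) u : Fin (N + 1) → Fin q))
  · intro u hu
    simp only [Finset.coe_filter, Finset.mem_univ, true_and, Set.mem_setOf_eq] at hu
    set w : Fin (N + 1) → Fin q := Fin.cons (⟨0, hq⟩ : Fin q) u with hw
    have h0 : cw w 0 = 0 := by
      have := cw_val w 0
      simpa [hw] using this
    have hu' : LynF (Fin.tail w) := by rw [hw, Fin.tail_cons]; exact hu
    simp only [Finset.coe_union, Finset.coe_filter, Finset.mem_univ, true_and, Set.mem_union,
      Set.mem_setOf_eq]
    by_cases hG : Gd L w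
    · exact Or.inl ⟨hG, tp_of_tail w hN hG h0 hu'⟩
    · exact Or.inr ⟨lynF_tail w hN h0 hu', hG⟩
  · intro u _ u' _ h
    exact Fin.cons_right_injective (α := fun _ => Fin q) _ h

end

end LynAux

namespace LynAux

section

variable {n q : ℕ} [NeZero n]

/-- No cyclic run of `k` zeros. -/
def NoRun (k : ℕ) (w : Fin n → Fin q) : Prop := ∀ i, ∃ t < k, cw w (i + t) ≠ 0

lemma card_noRun (k B : ℕ) (hq : 0 < q) (hk : 0 < k) (hB : B * k ≤ n) :
    (Finset.univ.filter fun w : Fin n → Fin q => NoRun k w).card ≤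
      (q ^ k - 1) ^ B * q ^ (n - B * k) := by
  set Z : Finset (Fin k → Fin q) := Finset.univ.erase (fun _ => (⟨0, hq⟩ : Fin q)) with hZ
  have hZc : Z.card = q ^ k - 1 := by
    rw [hZ, Finset.card_erase_of_mem (Finset.mem_univ _)]
    simp
  set TT : Finset ((Fin B → (Fin k → Fin q)) × (Fin (n - B * k) → Fin q)) :=
    (Fintype.piFinset fun _ : Fin B => Z) ×ˢ Finset.univ with hT
  have hTc : TT.card = (q ^ k - 1) ^ B * q ^ (n - B * k) := by
    rw [hT, Finset.card_product, Fintype.card_piFinset]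
    simp [hZc]
  rw [← hTc]
  apply Finset.card_le_card_of_injOn
    (fun w => (fun b c => w (Fin.ofNat n (b.val * k + c.val)), fun j => w (Fin.ofNat n (B * k + j.val))))
  · intro w hw
    simp only [Finset.coe_filter, Finset.mem_univ, true_and, Set.mem_setOf_eq] at hw
    simp only [hT, hZ, Finset.coe_product, Finset.coe_univ, Set.mem_prod, Set.mem_univ, and_true,
      Finset.mem_coe, Fintype.mem_piFinset, Finset.mem_erase, Finset.mem_univ]
    intro b hb
    obtain ⟨t, ht, hne⟩ := hw (b.val * k)
    apply hne
    have := congrFun hb ⟨t, ht⟩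
    simpa [cw] using congrArg Fin.val this
  · intro w _ w' _ he
    simp only [Prod.mk.injEq] at he
    apply cw_ext
    intro i hi
    unfold cw
    congr 1
    rcases Nat.lt_or_ge i (B * k) with h | h
    · have h1 : i / k < B := Nat.div_lt_of_lt_mul (by rwa [mul_comm])
      have := congrFun (congrFun he.1 ⟨i / k, h1⟩) ⟨i % k, Nat.mod_lt _ hk⟩
      simpa [Nat.div_add_mod'] using this
    · have := congrFun he.2 ⟨i - B * k, by omega⟩
      simp only at this
      rwa [show B * k + (i - B * k) = i by omega] at this

lemma win_prev {L : ℕ} {w : Fin n → Fin q} {i : ℕ} (h : cw w i = 0) :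
    win L w i ≤ win L w (i + 1) := by
  by_contra hc
  obtain ⟨k, _, h1, h2⟩ := win_lt_iff.1 (not_le.1 hc)
  have : ∀ t ≤ k, cw w (i + t) = 0 := by
    intro t
    induction t with
    | zero => intro _; simpa using h
    | succ t ih =>
      intro ht
      have := h1 t (by omega)
      rw [ih (by omega)] at this
      rw [← this]
      congr 1
      omega
  rw [this k le_rfl] at h2
  omega

lemma zeros_of_win_le {L k : ℕ} (hk : k ≤ L) {w : Fin n → Fin q} {a b : ℕ}
    (h : win L w a ≤ win L w b) (hb : ∀ t < k, cw w (b + t) = 0) : ∀ t < k, cw w (a + t) = 0 := by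
  by_contra hc
  push Not at hc
  classical
  obtain ⟨h1, h2⟩ := Nat.find_spec hc
  refine absurd h (not_le.2 (win_lt_iff.2 ⟨Nat.find hc, by omega, ?_, ?_⟩))
  · intro t ht
    have := Nat.find_min hc ht
    rw [hb t (by omega)]
    by_contra hne
    exact this ⟨by omega, fun h => hne h.symm⟩
  · rw [hb _ h1]
    omega

lemma close_zeros {L k : ℕ} (hk : k + 1 ≤ L) (hn : 2 ≤ n) {w : Fin n → Fin q} (hG : Gd L w)
    (hr : ¬ NoRun (k + 1) w) (hD : Dd L w ≠ 1) :
    (∀ t < k, cw w ((tp L w).1 + t) = 0) ∧ (∀ t < k, cw w ((tp L w).1 + Dd L w + t) = 0) ∧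
    k ≤ Dd L w ∧ Dd L w + k ≤ n := by
  obtain ⟨a1, a2, a3, a4, a5⟩ := tp_spec L w hn
  have hDn : Dd L w < n := Nat.mod_lt _ (NeZero.pos n)
  have hDp : ((tp L w).1 + Dd L w) % n = (tp L w).2 := by
    rw [add_comm, Dd, sub_mod_add a1, Nat.mod_eq_of_lt a2]
  set p := (tp L w).1
  set p' := (tp L w).2
  set D := Dd L w
  have hn0 := NeZero.pos n
  unfold NoRun at hr
  push Not at hr
  obtain ⟨r, hr⟩ := hr
  have z1 : ∀ t < k + 1, cw w (p + t) = 0 := by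
    apply zeros_of_win_le hk (a4 (r % n) (Nat.mod_lt _ hn0))
    intro t ht
    rw [← hr t ht]
    exact cw_congr w (by simp)
  have hp1 : (p + 1) % n ≠ p := by
    intro h
    have : (p + 1) % n = (p + 0) % n := by rw [h, add_zero, Nat.mod_eq_of_lt a1]
    have := mod_inj_of_lt (n := n) (by omega) (by omega) this
    omega
  have z2 : ∀ t < k, cw w (p' + t) = 0 := by
    apply zeros_of_win_le (by omega) (a5 ((p + 1) % n) (Nat.mod_lt _ hn0) hp1)
    intro t ht
    rw [← z1 (1 + t) (by omega)]
    apply cw_congr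
    rw [Nat.mod_add_mod]
    congr 1
    omega
  have z2' : ∀ t < k, cw w (p + D + t) = 0 := by
    intro t ht
    rw [← z2 t ht, ← hDp]
    apply cw_congr
    rw [Nat.mod_add_mod]
  have prevne : ∀ s < n, (s + (n - 1)) % n ≠ s := by
    intro s hs h
    have : (s + (n - 1)) % n = (s + 0) % n := by rw [h, add_zero, Nat.mod_eq_of_lt hs]
    have := mod_inj_of_lt (n := n) (by omega) (by omega) this
    omega
  have prevle : ∀ s, cw w (s + (n - 1)) = 0 → win L w ((s + (n - 1)) % n) ≤ win L w s := by
    intro s hs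
    have := win_prev (L := L) hs
    rw [show s + (n - 1) + 1 = s + n by omega] at this
    rw [win_congr L w (Nat.mod_mod (s + (n - 1)) n)]
    rwa [win_congr L w (i := s + n) (j := s) (by simp)] at this
  have n1 : cw w (p + (n - 1)) ≠ 0 := by
    intro h
    have h1 := prevle p h
    have h2 := a4 ((p + (n - 1)) % n) (Nat.mod_lt _ hn0)
    exact prevne p a1 (hG _ (Nat.mod_lt _ hn0) _ a1 (le_antisymm h1 h2))
  have n2 : cw w (p' + (n - 1)) ≠ 0 := by
    intro h
    have h1 := prevle p' h
    by_cases hj : (p' + (n - 1)) % n = p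
    · apply hD
      apply mod_inj_of_lt (a := p) hDn (by omega)
      rw [hDp, ← hj, Nat.mod_add_mod, show p' + (n - 1) + 1 = p' + n by omega]
      rw [Nat.add_mod_right, Nat.mod_eq_of_lt a2]
    · have h2 := a5 ((p' + (n - 1)) % n) (Nat.mod_lt _ hn0) hj
      exact prevne p' a2 (hG _ (Nat.mod_lt _ hn0) _ a2 (le_antisymm h1 h2))
  have hD0 : D ≠ 0 := by
    intro h
    rw [h, add_zero, Nat.mod_eq_of_lt a1] at hDp
    exact a3 hDp
  refine ⟨fun t ht => z1 t (by omega), z2', ?_, ?_⟩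
  · by_contra hc
    apply n2
    rw [← z1 (D - 1) (by omega), ← hDp]
    apply cw_congr
    rw [Nat.mod_add_mod, show p + D + (n - 1) = p + (D - 1) + n by omega, Nat.add_mod_right]
  · by_contra hc
    apply n1
    rw [← z2' (n - 1 - D) (by omega)]
    congr 1
    omega

lemma card_two_runs (k i d : ℕ) (h1 : k ≤ d) (h2 : d + k ≤ n) :
    (Finset.univ.filter fun w : Fin n → Fin q => (∀ t < k, cw w (i + t) = 0) ∧
      ∀ t < k, cw w (i + d + t) = 0).card * q ^ (2 * k) ≤ q ^ n := by
  set S : Finset (Fin n) := (Finset.range k ∪ Finset.Ico d (d + k)).image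
    (fun t => Fin.ofNat n (i + t)) with hS
  have hc : S.card = 2 * k := by
    rw [hS, Finset.card_image_of_injOn, Finset.card_union_of_disjoint]
    · simp; omega
    · rw [Finset.disjoint_left]
      intro a ha hb
      simp at ha hb
      omega
    · intro s hs t ht h
      simp at hs ht
      have h' : (i + s) % n = (i + t) % n := by
        simpa [Fin.ofNat] using congrArg Fin.val h
      exact mod_inj_of_lt (by omega) (by omega) h'
  rw [← hc]
  apply card_determ
  intro w hw w' hw' he
  simp only [Finset.mem_filter, Finset.mem_univ, true_and] at hw hw'
  funext j
  by_cases hj : j ∈ S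
  · rw [hS] at hj
    simp only [Finset.mem_image, Finset.mem_union, Finset.mem_range, Finset.mem_Ico] at hj
    obtain ⟨t, ht, rfl⟩ := hj
    apply Fin.ext
    show cw w (i + t) = cw w' (i + t)
    rcases ht with ht | ht
    · rw [hw.1 t ht, hw'.1 t ht]
    · have e1 := hw.2 (t - d) (by omega)
      have e2 := hw'.2 (t - d) (by omega)
      rw [show i + d + (t - d) = i + t by omega] at e1 e2
      rw [e1, e2]
  · exact he j hj

lemma card_close (L k m : ℕ) (hk : k + 1 ≤ L) (hn : 2 ≤ n) :
    (Finset.univ.filter fun w : Fin n → Fin q => (Gd L w ∧ Dd L w ≠ 1 ∧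
      (Dd L w < m ∨ n < Dd L w + m)) ∧ ¬ NoRun (k + 1) w).card * q ^ (2 * k) ≤
      2 * n * m * q ^ n := by
  set I : Finset (ℕ × ℕ) := ((Finset.range n) ×ˢ (Finset.range m ∪ Finset.Ico (n + 1 - m) n)).filter
    (fun p => k ≤ p.2 ∧ p.2 + k ≤ n) with hI
  have hIc : I.card ≤ 2 * n * m := by
    refine (Finset.card_filter_le _ _).trans ?_
    rw [Finset.card_product, Finset.card_range]
    have : (Finset.range m ∪ Finset.Ico (n + 1 - m) n).card ≤ 2 * m := by
      refine (Finset.card_union_le _ _).trans ?_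
      simp
      omega
    calc n * _ ≤ n * (2 * m) := Nat.mul_le_mul_left _ this
      _ = _ := by ring
  have hsub : (Finset.univ.filter fun w : Fin n → Fin q => (Gd L w ∧ Dd L w ≠ 1 ∧
      (Dd L w < m ∨ n < Dd L w + m)) ∧ ¬ NoRun (k + 1) w) ⊆ I.biUnion fun p =>
      Finset.univ.filter fun w : Fin n → Fin q => (∀ t < k, cw w (p.1 + t) = 0) ∧
      ∀ t < k, cw w (p.1 + p.2 + t) = 0 := by
    intro w hw
    obtain ⟨⟨hG, hD, hm⟩, hr⟩ := (Finset.mem_filter.1 hw).2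
    obtain ⟨b1, b2, b3, b4⟩ := close_zeros hk hn hG hr hD
    have hDn : Dd L w < n := Nat.mod_lt _ (NeZero.pos n)
    simp only [hI, Finset.mem_biUnion, Finset.mem_filter, Finset.mem_product, Finset.mem_range,
      Finset.mem_univ, true_and, Finset.mem_union, Finset.mem_Ico]
    refine ⟨((tp L w).1, Dd L w), ⟨⟨(tp_spec L w hn).1, ?_⟩, b3, b4⟩, b1, b2⟩
    omega
  calc _ ≤ (∑ p ∈ I, (Finset.univ.filter fun w : Fin n → Fin q =>
        (∀ t < k, cw w (p.1 + t) = 0) ∧ ∀ t < k, cw w (p.1 + p.2 + t) = 0).card) * q ^ (2 * k) :=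
        Nat.mul_le_mul_right _ ((Finset.card_le_card hsub).trans Finset.card_biUnion_le)
    _ ≤ ∑ p ∈ I, q ^ n := by
        rw [Finset.sum_mul]
        apply Finset.sum_le_sum
        intro p hp
        simp only [hI, Finset.mem_filter] at hp
        exact card_two_runs k p.1 p.2 hp.2.1 hp.2.2
    _ ≤ _ := by
        rw [Finset.sum_const, smul_eq_mul]
        exact Nat.mul_le_mul_right _ hIc

end

end LynAux

namespace LynAux

section

variable {M : ℕ}

/-- Extension of a permutation of `Fin M` to natural numbers. -/
def se (σ : Equiv.Perm (Fin M)) (a : ℕ) : ℕ := if h : a < M then (σ ⟨a, h⟩).val else a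

lemma se_of_lt (σ : Equiv.Perm (Fin M)) {a : ℕ} (h : a < M) : se σ a = (σ ⟨a, h⟩).val := by
  unfold se; rw [dif_pos h]

lemma se_of_ge (σ : Equiv.Perm (Fin M)) {a : ℕ} (h : ¬ a < M) : se σ a = a := by
  unfold se; rw [dif_neg h]

lemma se_lt (σ : Equiv.Perm (Fin M)) {a : ℕ} (h : a < M) : se σ a < M := by
  rw [se_of_lt σ h]; exact Fin.isLt _

lemma se_inv (σ : Equiv.Perm (Fin M)) (a : ℕ) : se σ (se σ⁻¹ a) = a := by
  by_cases h : a < M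
  · rw [se_of_lt σ (se_lt _ h)]
    simp [se_of_lt σ⁻¹ h]
  · rw [se_of_ge σ⁻¹ h, se_of_ge σ h]

lemma se_inv' (σ : Equiv.Perm (Fin M)) (a : ℕ) : se σ⁻¹ (se σ a) = a := by
  have := se_inv σ⁻¹ a
  rwa [inv_inv] at this

lemma perm_count (T : Fin M → Fin M → Prop) {a b : Fin M} (hab : a ≠ b) :
    (Finset.univ.filter fun σ : Equiv.Perm (Fin M) => T (σ⁻¹ a) (σ⁻¹ b)).card * (M * M - M) =
      M.factorial * ((Finset.univ : Finset (Fin M)).offDiag.filter fun p => T p.1 p.2).card := by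
  have hconst : ∀ p ∈ (Finset.univ : Finset (Fin M)).offDiag,
      (Finset.univ.filter fun σ : Equiv.Perm (Fin M) => T (σ⁻¹ p.1) (σ⁻¹ p.2)).card =
      (Finset.univ.filter fun σ : Equiv.Perm (Fin M) => T (σ⁻¹ a) (σ⁻¹ b)).card := by
    rintro ⟨c, d⟩ hcd
    simp only [Finset.mem_offDiag, Finset.mem_univ, true_and] at hcd
    obtain ⟨ρ, h1, h2⟩ : ∃ ρ : Equiv.Perm (Fin M), ρ a = c ∧ ρ b = d := by
      refine ⟨Equiv.swap (Equiv.swap a c b) d * Equiv.swap a c, ?_, ?_⟩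
      · simp only [Equiv.Perm.mul_apply, Equiv.swap_apply_left]
        apply Equiv.swap_apply_of_ne_of_ne _ hcd
        intro h
        have : Equiv.swap a c a = Equiv.swap a c b := by rw [← h, Equiv.swap_apply_left]
        exact hab ((Equiv.swap a c).injective this)
      · simp
    symm
    apply Finset.card_bij' (fun σ _ => ρ * σ) (fun σ _ => ρ⁻¹ * σ)
    · intro σ hσ
      simp only [Finset.mem_filter, Finset.mem_univ, true_and] at hσ ⊢
      simpa [← h1, ← h2, mul_inv_rev] using hσ
    · intro σ hσ
      simp only [Finset.mem_filter, Finset.mem_univ, true_and] at hσ ⊢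
      simpa [← h1, ← h2, mul_inv_rev] using hσ
    · intro σ _; simp
    · intro σ _; simp
  have hcard : (Finset.univ : Finset (Fin M)).offDiag.card = M * M - M := by
    rw [Finset.offDiag_card]; simp
  have h1 : ∑ p ∈ (Finset.univ : Finset (Fin M)).offDiag,
      (Finset.univ.filter fun σ : Equiv.Perm (Fin M) => T (σ⁻¹ p.1) (σ⁻¹ p.2)).card =
      (M * M - M) *
        (Finset.univ.filter fun σ : Equiv.Perm (Fin M) => T (σ⁻¹ a) (σ⁻¹ b)).card := by
    rw [Finset.sum_congr rfl hconst, Finset.sum_const, hcard, smul_eq_mul]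
  rw [mul_comm, ← h1]
  simp_rw [Finset.card_filter]
  rw [Finset.sum_comm]
  rw [Finset.sum_congr rfl (g := fun _ => ∑ p ∈ (Finset.univ : Finset (Fin M)).offDiag,
    if T p.1 p.2 then 1 else 0)]
  · rw [Finset.sum_const, smul_eq_mul]
    congr 1
    rw [Finset.card_univ, Fintype.card_perm, Fintype.card_fin]
  · intro σ _
    apply Finset.sum_bij' (fun p _ => (σ⁻¹ p.1, σ⁻¹ p.2)) (fun p _ => (σ p.1, σ p.2))
    · intro p hp
      simpa using hp
    · intro p hp
      simpa using hp
    · intro p _; simp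
    · intro p _; simp
    · intro p _; rfl

end

section

variable {n q M : ℕ} [NeZero n]

/-- The position permutation permuting arcs of length `m`. -/
def tau (m : ℕ) (σ : Equiv.Perm (Fin M)) (i : ℕ) : ℕ := se σ (i / m) * m + i % m

lemma tau_div {m : ℕ} (hm : 0 < m) (σ : Equiv.Perm (Fin M)) (i : ℕ) :
    tau m σ i / m = se σ (i / m) := by
  unfold tau
  rw [mul_comm, Nat.mul_add_div hm, Nat.div_eq_of_lt (Nat.mod_lt _ hm), add_zero]

lemma tau_mod {m : ℕ} (hm : 0 < m) (σ : Equiv.Perm (Fin M)) (i : ℕ) :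
    tau m σ i % m = i % m := by
  unfold tau
  rw [mul_comm, Nat.mul_add_mod, Nat.mod_mod]

lemma tau_inv {m : ℕ} (hm : 0 < m) (σ : Equiv.Perm (Fin M)) (i : ℕ) :
    tau m σ (tau m σ⁻¹ i) = i := by
  have : tau m σ (tau m σ⁻¹ i) = se σ (tau m σ⁻¹ i / m) * m + tau m σ⁻¹ i % m := rfl
  rw [this, tau_div hm, tau_mod hm, se_inv, Nat.div_add_mod']

lemma tau_inv' {m : ℕ} (hm : 0 < m) (σ : Equiv.Perm (Fin M)) (i : ℕ) :
    tau m σ⁻¹ (tau m σ i) = i := by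
  have := tau_inv hm σ⁻¹ i
  rwa [inv_inv] at this

lemma lt_of_div {m i : ℕ} (hm : 0 < m) (hM : M * m ≤ n) (h : i / m < M) : i < n :=
  ((Nat.div_lt_iff_lt_mul hm).1 h).trans_le hM

lemma tau_lt {m : ℕ} (hm : 0 < m) (hM : M * m ≤ n) (σ : Equiv.Perm (Fin M)) {i : ℕ} (hi : i < n) :
    tau m σ i < n := by
  by_cases h : i / m < M
  · apply lt_of_div hm hM
    rw [tau_div hm]
    exact se_lt σ h
  · unfold tau
    rw [se_of_ge σ h, Nat.div_add_mod']
    exact hi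

/-- Action of arc permutations on words. -/
def act (m : ℕ) (σ : Equiv.Perm (Fin M)) (w : Fin n → Fin q) : Fin n → Fin q :=
  fun i => w (Fin.ofNat n (tau m σ i.val))

lemma cw_act (m : ℕ) (σ : Equiv.Perm (Fin M)) (w : Fin n → Fin q) {i : ℕ} (hi : i < n) :
    cw (act m σ w) i = cw w (tau m σ i) := by
  have := cw_val (act m σ w) ⟨i, hi⟩
  simp only at this
  rw [this]
  rfl

lemma act_act {m : ℕ} (hm : 0 < m) (hM : M * m ≤ n) (σ : Equiv.Perm (Fin M)) (w : Fin n → Fin q) :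
    act m σ (act m σ⁻¹ w) = w := by
  apply cw_ext
  intro i hi
  rw [cw_act _ _ _ hi, cw_act _ _ _ (tau_lt hm hM σ hi), tau_inv' hm]

lemma act_inj {m : ℕ} (hm : 0 < m) (hM : M * m ≤ n) (σ : Equiv.Perm (Fin M)) :
    Function.Injective (act (n := n) (q := q) m σ) := by
  intro w w' h
  have a := act_act hm hM σ⁻¹ w
  have b := act_act hm hM σ⁻¹ w'
  rw [inv_inv] at a b
  rw [← a, ← b, h]

lemma card_act {m : ℕ} (hm : 0 < m) (hM : M * m ≤ n) (σ : Equiv.Perm (Fin M))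
    (P : (Fin n → Fin q) → Prop) :
    (Finset.univ.filter fun w => P (act m σ w)).card = (Finset.univ.filter fun w => P w).card := by
  apply le_antisymm
  · apply Finset.card_le_card_of_injOn (act m σ)
    · intro w hw
      simpa using hw
    · exact (act_inj hm hM σ).injOn
  · apply Finset.card_le_card_of_injOn (act m σ⁻¹)
    · intro w hw
      simp at hw ⊢
      rwa [act_act hm hM]
    · exact (act_inj hm hM _).injOn

/-- Inner positions. -/
def Inn (M L m i : ℕ) : Prop := i / m < M ∧ i % m + L ≤ m

lemma inn_tau {L m : ℕ} (hm : 0 < m) (σ : Equiv.Perm (Fin M)) {i : ℕ} (h : Inn M L m i) :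
    Inn M L m (tau m σ i) := by
  refine ⟨?_, ?_⟩
  · rw [tau_div hm]; exact se_lt σ h.1
  · rw [tau_mod hm]; exact h.2

lemma inn_add {L m : ℕ} (hm : 0 < m) {i t : ℕ} (h : Inn M L m i) (ht : t < L) :
    (i + t) / m = i / m ∧ (i + t) % m = i % m + t := by
  have h2 := h.2
  have e : i + t = m * (i / m) + (i % m + t) := by
    have := Nat.div_add_mod i m
    omega
  have hlt : i % m + t < m := by omega
  constructor
  · conv_lhs => rw [e]
    rw [Nat.mul_add_div hm, Nat.div_eq_of_lt hlt, add_zero]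
  · conv_lhs => rw [e]
    rw [Nat.mul_add_mod, Nat.mod_eq_of_lt hlt]

lemma win_act {L m : ℕ} (hm : 0 < m) (hM : M * m ≤ n) (σ : Equiv.Perm (Fin M)) (w : Fin n → Fin q)
    {i : ℕ} (h : Inn M L m i) : win L (act m σ w) i = win L w (tau m σ i) := by
  rw [win_eq_iff]
  intro t ht
  obtain ⟨h1, h2⟩ := inn_add hm h ht
  have hlt : i + t < n := lt_of_div hm hM (by rw [h1]; exact h.1)
  rw [cw_act _ _ _ hlt]
  congr 1
  unfold tau
  rw [h1, h2, add_assoc]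

/-- Good words with inner extremal positions. -/
def Hh (M L m : ℕ) (w : Fin n → Fin q) : Prop :=
  Gd L w ∧ Inn M L m (tp L w).1 ∧ Inn M L m (tp L w).2

lemma tp_act {L m : ℕ} (hn : 2 ≤ n) (hm : 0 < m) (hM : M * m ≤ n) (σ : Equiv.Perm (Fin M))
    {w : Fin n → Fin q} (hw : Hh M L m w) (hv : Hh M L m (act m σ w)) :
    (tp L w).1 = tau m σ (tp L (act m σ w)).1 ∧ (tp L w).2 = tau m σ (tp L (act m σ w)).2 := by
  obtain ⟨hG, i1, i2⟩ := hw
  obtain ⟨hG', j1, j2⟩ := hv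
  obtain ⟨a1, a2, a3, a4, a5⟩ := tp_spec L w hn
  obtain ⟨b1, b2, b3, b4, b5⟩ := tp_spec L (act m σ w) hn
  have fwd : ∀ i, Inn M L m i → win L (act m σ w) i = win L w (tau m σ i) := fun i hi =>
    win_act hm hM σ w hi
  have bwd : ∀ i, Inn M L m i → win L (act m σ w) (tau m σ⁻¹ i) = win L w i := by
    intro i hi
    rw [fwd _ (inn_tau hm σ⁻¹ hi), tau_inv hm]
  have e1 : (tp L w).1 = tau m σ (tp L (act m σ w)).1 := by
    apply hG _ a1 _ (tau_lt hm hM σ b1)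
    apply le_antisymm (a4 _ (tau_lt hm hM σ b1))
    rw [← fwd _ j1, ← bwd _ i1]
    exact b4 _ (tau_lt hm hM _ a1)
  refine ⟨e1, ?_⟩
  apply hG _ a2 _ (tau_lt hm hM σ b2)
  apply le_antisymm
  · apply a5 _ (tau_lt hm hM σ b2)
    rw [e1]
    intro h
    have := congrArg (tau m σ⁻¹) h
    rw [tau_inv' hm, tau_inv' hm] at this
    exact b3 this.symm
  · rw [← fwd _ j2, ← bwd _ i2]
    apply b5 _ (tau_lt hm hM _ a2)
    intro h
    have := congrArg (tau m σ) h
    rw [tau_inv hm, ← e1] at this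
    exact a3 this.symm

lemma averaging {L m : ℕ} (hn : 2 ≤ n) (hm : 0 < m) (hM : M * m ≤ n) (T : ℕ → ℕ → Prop)
    (X N h τ : ℕ)
    (hX : X = (Finset.univ.filter fun w : Fin n → Fin q => Hh M L m w ∧
      (tp L w).1 / m ≠ (tp L w).2 / m ∧ T ((tp L w).1 / m) ((tp L w).2 / m)).card)
    (hN : N = (Finset.univ.filter fun w : Fin n → Fin q => Hh M L m w ∧
      (tp L w).1 / m ≠ (tp L w).2 / m).card)
    (hh : h = (Finset.univ.filter fun w : Fin n → Fin q => ¬ Hh M L m w).card)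
    (hτ : τ = ((Finset.univ : Finset (Fin M)).offDiag.filter fun p => T p.1.val p.2.val).card) :
    X * (M * M - M) ≤ N * τ + h * (M * M - M) ∧ N * τ ≤ X * (M * M - M) + h * (M * M - M) := by
  set Y : Equiv.Perm (Fin M) → ℕ := fun σ => (Finset.univ.filter fun w : Fin n → Fin q =>
    (Hh M L m w ∧ (tp L w).1 / m ≠ (tp L w).2 / m) ∧
      T (se σ⁻¹ ((tp L w).1 / m)) (se σ⁻¹ ((tp L w).2 / m))).card with hY
  have harc : ∀ σ : Equiv.Perm (Fin M), ∀ w : Fin n → Fin q, Hh M L m w → Hh M L m (act m σ w) →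
      (tp L (act m σ w)).1 / m = se σ⁻¹ ((tp L w).1 / m) ∧
      (tp L (act m σ w)).2 / m = se σ⁻¹ ((tp L w).2 / m) := by
    intro σ w hw hv
    obtain ⟨e1, e2⟩ := tp_act hn hm hM σ hw hv
    rw [e1, e2, tau_div hm, tau_div hm, se_inv', se_inv']
    exact ⟨rfl, rfl⟩
  have hse : ∀ (σ : Equiv.Perm (Fin M)) (a b : ℕ), se σ⁻¹ a ≠ se σ⁻¹ b ↔ a ≠ b := by
    intro σ a b
    refine not_congr ⟨fun hab => ?_, fun hab => by rw [hab]⟩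
    have := congrArg (se σ) hab
    rwa [se_inv, se_inv] at this
  have hXY : ∀ σ, X ≤ Y σ + h := by
    intro σ
    have c1 : X = (Finset.univ.filter fun w : Fin n → Fin q => Hh M L m (act m σ w) ∧
        (tp L (act m σ w)).1 / m ≠ (tp L (act m σ w)).2 / m ∧
        T ((tp L (act m σ w)).1 / m) ((tp L (act m σ w)).2 / m)).card := by
      rw [hX]
      convert (card_act hm hM σ (fun w : Fin n → Fin q => Hh M L m w ∧
        (tp L w).1 / m ≠ (tp L w).2 / m ∧ T ((tp L w).1 / m) ((tp L w).2 / m))).symm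
    rw [c1, hh]
    refine le_trans (Finset.card_le_card ?_) (Finset.card_union_le _ _)
    intro w hw
    replace hw := (Finset.mem_filter.1 hw).2
    rw [Finset.mem_union, Finset.mem_filter, Finset.mem_filter]
    by_cases hc : Hh M L m w
    · left
      obtain ⟨e1, e2⟩ := harc σ w hc hw.1
      rw [e1, e2, hse] at hw
      exact ⟨Finset.mem_univ _, ⟨hc, hw.2.1⟩, hw.2.2⟩
    · right
      exact ⟨Finset.mem_univ _, hc⟩
  have hYX : ∀ σ, Y σ ≤ X + h := by
    intro σ
    have c1 : X = (Finset.univ.filter fun w : Fin n → Fin q => Hh M L m (act m σ w) ∧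
        (tp L (act m σ w)).1 / m ≠ (tp L (act m σ w)).2 / m ∧
        T ((tp L (act m σ w)).1 / m) ((tp L (act m σ w)).2 / m)).card := by
      rw [hX]
      convert (card_act hm hM σ (fun w : Fin n → Fin q => Hh M L m w ∧
        (tp L w).1 / m ≠ (tp L w).2 / m ∧ T ((tp L w).1 / m) ((tp L w).2 / m))).symm
    have c2 : h = (Finset.univ.filter fun w : Fin n → Fin q => ¬ Hh M L m (act m σ w)).card := by
      rw [hh]
      convert (card_act hm hM σ (fun w : Fin n → Fin q => ¬ Hh M L m w)).symm
    rw [c1, c2]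
    refine le_trans (Finset.card_le_card ?_) (Finset.card_union_le _ _)
    intro w hw
    replace hw := (Finset.mem_filter.1 hw).2
    rw [Finset.mem_union, Finset.mem_filter, Finset.mem_filter]
    by_cases hc : Hh M L m (act m σ w)
    · left
      obtain ⟨e1, e2⟩ := harc σ w hw.1.1 hc
      rw [e1, e2, hse]
      exact ⟨Finset.mem_univ _, hc, hw.1.2, hw.2⟩
    · right
      exact ⟨Finset.mem_univ _, hc⟩
  have hsum : (∑ σ, Y σ) * (M * M - M) = N * (M.factorial * τ) := by
    have : ∑ σ, Y σ = ∑ w ∈ (Finset.univ.filter fun w : Fin n → Fin q => Hh M L m w ∧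
        (tp L w).1 / m ≠ (tp L w).2 / m), (Finset.univ.filter fun σ : Equiv.Perm (Fin M) =>
          T (se σ⁻¹ ((tp L w).1 / m)) (se σ⁻¹ ((tp L w).2 / m))).card := by
      simp only [hY]
      simp_rw [← Finset.filter_filter (fun w : Fin n → Fin q => Hh M L m w ∧
        (tp L w).1 / m ≠ (tp L w).2 / m), Finset.card_filter _ (Finset.univ), Finset.card_filter]
      rw [Finset.sum_comm]
    rw [this, Finset.sum_mul, Finset.sum_congr rfl (g := fun _ => M.factorial * τ)]
    · rw [Finset.sum_const, smul_eq_mul, hN]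
    · intro w hw
      obtain ⟨hw1, hw2⟩ := (Finset.mem_filter.1 hw).2
      have := perm_count (M := M) (fun a b => T a.val b.val)
        (a := ⟨(tp L w).1 / m, hw1.2.1.1⟩) (b := ⟨(tp L w).2 / m, hw1.2.2.1⟩) (by
          intro h
          exact hw2 (congrArg Fin.val h))
      rw [hτ, ← this]
      congr 2
      apply Finset.filter_congr
      intro σ _
      rw [se_of_lt σ⁻¹ hw1.2.1.1, se_of_lt σ⁻¹ hw1.2.2.1]
  have hfac : 0 < M.factorial := Nat.factorial_pos M
  have hcardσ : (Finset.univ : Finset (Equiv.Perm (Fin M))).card = M.factorial := by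
    rw [Finset.card_univ, Fintype.card_perm, Fintype.card_fin]
  have s1 : M.factorial * X ≤ (∑ σ, Y σ) + M.factorial * h := by
    have := Finset.sum_le_sum (s := Finset.univ) fun σ _ => hXY σ
    simpa [Finset.sum_add_distrib, hcardσ, Fintype.card_perm] using this
  have s2 : (∑ σ, Y σ) ≤ M.factorial * X + M.factorial * h := by
    have := Finset.sum_le_sum (s := Finset.univ) fun σ _ => hYX σ
    rw [← Nat.mul_add]
    simpa [Finset.sum_add_distrib, hcardσ, Fintype.card_perm] using this
  constructor
  · apply Nat.le_of_mul_le_mul_left _ hfac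
    calc M.factorial * (X * (M * M - M)) = (M.factorial * X) * (M * M - M) := by ring
      _ ≤ ((∑ σ, Y σ) + M.factorial * h) * (M * M - M) := Nat.mul_le_mul_right _ s1
      _ = (∑ σ, Y σ) * (M * M - M) + M.factorial * (h * (M * M - M)) := by ring
      _ = _ := by rw [hsum]; ring
  · apply Nat.le_of_mul_le_mul_left _ hfac
    calc M.factorial * (N * τ) = N * (M.factorial * τ) := by ring
      _ = (∑ σ, Y σ) * (M * M - M) := hsum.symm
      _ ≤ (M.factorial * X + M.factorial * h) * (M * M - M) := Nat.mul_le_mul_right _ s2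
      _ = _ := by ring

lemma card_T (t : ℕ) (ht : t < M) :
    ((Finset.univ : Finset (Fin M)).offDiag.filter
      fun p => (p.1.val + M - p.2.val) % M ≤ t).card = M * t := by
  have : ((Finset.univ : Finset (Fin M)) ×ˢ Finset.Icc 1 t).card = M * t := by simp
  rw [← this]
  symm
  have hM : 0 < M := by omega
  haveI : NeZero M := ⟨by omega⟩
  refine Finset.card_bij'
    (fun p _ => ((⟨(p.1.val + p.2) % M, Nat.mod_lt _ hM⟩ : Fin M), p.1))
    (fun p _ => (p.2, (p.1.val + M - p.2.val) % M)) ?_ ?_ ?_ ?_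
  · rintro ⟨b, d⟩ h
    simp only [Finset.mem_product, Finset.mem_univ, true_and, Finset.mem_Icc] at h
    simp only [Finset.mem_filter, Finset.mem_offDiag, Finset.mem_univ, true_and]
    have hb := b.isLt
    have key : ((b.val + d) % M + M - b.val) % M = d := by
      rcases Nat.lt_or_ge (b.val + d) M with h' | h'
      · rw [Nat.mod_eq_of_lt h', show b.val + d + M - b.val = d + M by omega, Nat.add_mod_right,
          Nat.mod_eq_of_lt (by omega)]
      · rw [Nat.mod_eq_sub_mod h', Nat.mod_eq_of_lt (a := b.val + d - M) (by omega),
          show b.val + d - M + M - b.val = d by omega, Nat.mod_eq_of_lt (by omega)]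
    refine ⟨?_, by rw [key]; exact h.2⟩
    intro hne
    have := congrArg Fin.val hne
    simp only at this
    rw [this, show b.val + M - b.val = M by omega, Nat.mod_self] at key
    omega
  · rintro ⟨a, b⟩ h
    simp only [Finset.mem_filter, Finset.mem_offDiag, Finset.mem_univ, true_and] at h
    simp only [Finset.mem_product, Finset.mem_univ, true_and, Finset.mem_Icc]
    refine ⟨?_, h.2⟩
    by_contra hc
    have h0 : (a.val + M - b.val) % M = (b.val + M - b.val) % M := by
      rw [show b.val + M - b.val = M by omega, Nat.mod_self]; omega
    exact h.1 (Fin.ext (sub_mod_inj a.isLt b.isLt b.isLt h0))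
  · rintro ⟨b, d⟩ h
    simp only [Finset.mem_product, Finset.mem_univ, true_and, Finset.mem_Icc] at h
    have hb := b.isLt
    simp only [Prod.mk.injEq, true_and]
    rcases Nat.lt_or_ge (b.val + d) M with h' | h'
    · rw [Nat.mod_eq_of_lt h', show b.val + d + M - b.val = d + M by omega, Nat.add_mod_right,
        Nat.mod_eq_of_lt (by omega)]
    · rw [Nat.mod_eq_sub_mod h', Nat.mod_eq_of_lt (a := b.val + d - M) (by omega),
        show b.val + d - M + M - b.val = d by omega, Nat.mod_eq_of_lt (by omega)]
  · rintro ⟨a, b⟩ h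
    simp only [Prod.mk.injEq, and_true]
    apply Fin.ext
    simp only
    rw [add_comm, sub_mod_add b.isLt, Nat.mod_eq_of_lt a.isLt]

lemma card_not_inn (L m : ℕ) (hm : 0 < m) (hL : L ≤ m) :
    ((Finset.range n).filter fun i => ¬ Inn M L m i).card ≤ M * L + (n - M * m) := by
  have hsub : ((Finset.range n).filter fun i => ¬ Inn M L m i) ⊆
      ((Finset.range M ×ˢ Finset.range L).image fun p => p.1 * m + (m - L + p.2)) ∪
        Finset.Ico (M * m) n := by
    intro i hi
    simp only [Finset.mem_filter, Finset.mem_range, Inn, not_and, not_le] at hi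
    simp only [Finset.mem_union, Finset.mem_image, Finset.mem_product, Finset.mem_range,
      Finset.mem_Ico, Prod.exists]
    by_cases h : i / m < M
    · left
      have h2 := hi.2 h
      have h3 := Nat.mod_lt i hm
      refine ⟨i / m, i % m + L - m, ⟨h, by omega⟩, ?_⟩
      have := Nat.div_add_mod' i m
      omega
    · right
      exact ⟨by rw [not_lt, Nat.le_div_iff_mul_le hm] at h; exact h, hi.1⟩
  refine (Finset.card_le_card hsub).trans ((Finset.card_union_le _ _).trans ?_)
  apply Nat.add_le_add
  · refine Finset.card_image_le.trans ?_
    simp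
  · simp

lemma card_not_H (L m : ℕ) (hn : 2 ≤ n) (hm : 0 < m) (hL : L ≤ m) :
    n * (Finset.univ.filter fun w : Fin n → Fin q => ¬ Hh M L m w).card ≤
      n * (Finset.univ.filter fun w : Fin n → Fin q => ¬ Gd L w).card +
      2 * (M * L + (n - M * m)) * q ^ n := by
  set S := ((Finset.range n).filter fun i => ¬ Inn M L m i) with hS
  have hsub : (Finset.univ.filter fun w : Fin n → Fin q => ¬ Hh M L m w) ⊆
      (Finset.univ.filter fun w : Fin n → Fin q => ¬ Gd L w) ∪
      ((Finset.univ.filter fun w : Fin n → Fin q => Gd L w ∧ (tp L w).1 ∈ S) ∪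
      (Finset.univ.filter fun w : Fin n → Fin q => Gd L w ∧ (tp L w).2 ∈ S)) := by
    intro w hw
    replace hw := (Finset.mem_filter.1 hw).2
    have ht := tp_spec L w hn
    simp only [Finset.mem_union, Finset.mem_filter, Finset.mem_univ, true_and, hS,
      Finset.mem_range]
    unfold Hh at hw
    have := ht.1
    have := ht.2.1
    tauto
  have h1 := card_p1_mem (n := n) (q := q) L hn S (Finset.filter_subset _ _)
  have h2 := card_p2_mem (n := n) (q := q) L hn S (Finset.filter_subset _ _)
  have h3 : S.card ≤ M * L + (n - M * m) := card_not_inn L m hm hL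
  have h4 : S.card * q ^ n ≤ (M * L + (n - M * m)) * q ^ n := Nat.mul_le_mul_right _ h3
  have h5 := (Finset.card_le_card hsub).trans ((Finset.card_union_le _ _).trans
    (Nat.add_le_add_left (Finset.card_union_le _ _) _))
  have h6 := Nat.mul_le_mul_left n h5
  rw [Nat.mul_add, Nat.mul_add] at h6
  rw [show 2 * (M * L + (n - M * m)) * q ^ n = (M * L + (n - M * m)) * q ^ n +
    (M * L + (n - M * m)) * q ^ n by ring]
  omega

end

end LynAux

namespace LynAux

section

variable {n q : ℕ}

/-- Number of words with a given property. -/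
noncomputable def cnt (P : (Fin n → Fin q) → Prop) : ℕ :=
  (@Finset.filter _ P (Classical.decPred P) Finset.univ).card

lemma cnt_eq (P : (Fin n → Fin q) → Prop) [DecidablePred P] :
    (Finset.univ.filter P).card = cnt P := by
  unfold cnt
  congr

lemma cnt_mono {P Q : (Fin n → Fin q) → Prop} (h : ∀ w, P w → Q w) : cnt P ≤ cnt Q := by
  unfold cnt
  apply Finset.card_le_card
  intro w hw
  rw [Finset.mem_filter] at hw ⊢
  exact ⟨hw.1, h w hw.2⟩

lemma cnt_congr {P Q : (Fin n → Fin q) → Prop} (h : ∀ w, P w ↔ Q w) : cnt P = cnt Q :=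
  le_antisymm (cnt_mono fun w => (h w).1) (cnt_mono fun w => (h w).2)

lemma cnt_le_add {P Q R : (Fin n → Fin q) → Prop} (h : ∀ w, P w → Q w ∨ R w) :
    cnt P ≤ cnt Q + cnt R := by
  unfold cnt
  refine le_trans (Finset.card_le_card ?_) (Finset.card_union_le _ _)
  intro w hw
  rw [Finset.mem_filter] at hw
  rw [Finset.mem_union, Finset.mem_filter, Finset.mem_filter]
  rcases h w hw.2 with h | h
  · exact Or.inl ⟨hw.1, h⟩
  · exact Or.inr ⟨hw.1, h⟩

lemma cnt_split (P Q : (Fin n → Fin q) → Prop) :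
    cnt P = cnt (fun w => P w ∧ Q w) + cnt (fun w => P w ∧ ¬ Q w) := by
  rw [← cnt_eq, ← cnt_eq, ← cnt_eq, ← Finset.filter_filter, ← Finset.filter_filter,
    Finset.card_filter_add_card_filter_not]

lemma cnt_not (P : (Fin n → Fin q) → Prop) :
    cnt P + cnt (fun w => ¬ P w) = q ^ n := by
  rw [← cnt_eq, ← cnt_eq, Finset.card_filter_add_card_filter_not]
  simp

end

section

variable {n q : ℕ} [NeZero n]

lemma lyn_bounds (L : ℕ) (hn : 2 ≤ n) :
    n * cnt (fun w : Fin n → Fin q => LynF w) ≤ q ^ n ∧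
    q ^ n ≤ n * cnt (fun w : Fin n → Fin q => LynF w) + cnt (fun w : Fin n → Fin q => ¬ Gd L w) := by
  have h1 := card_D (n := n) (q := q) L hn (fun _ => True)
  have h2 := card_lyn_notG (n := n) (q := q) L
  rw [cnt_eq, cnt_eq] at h1 h2
  have h3 := cnt_split (fun w : Fin n → Fin q => LynF w) (fun w => Gd L w)
  have h4 := cnt_not (fun w : Fin n → Fin q => Gd L w)
  have h5 : cnt (fun w : Fin n → Fin q => Gd L w ∧ True) = cnt (fun w : Fin n → Fin q => Gd L w) :=
    cnt_congr fun w => by simp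
  have h6 : cnt (fun w : Fin n → Fin q => LynF w ∧ Gd L w) =
      cnt (fun w : Fin n → Fin q => Gd L w ∧ (tp L w).1 = 0 ∧ True) := by
    apply cnt_congr
    intro w
    constructor
    · rintro ⟨a, b⟩
      exact ⟨b, p1_of_lynF hn b a, trivial⟩
    · rintro ⟨b, a, _⟩
      exact ⟨lynF_of_p1 hn b a, b⟩
  rw [h3, Nat.mul_add, h6]
  omega

lemma num_bounds (L K : ℕ) (hn : 2 ≤ n) :
    cnt (fun w : Fin n → Fin q => Gd L w ∧ n - Dd L w ≤ K) ≤
      n * cnt (fun w : Fin n → Fin q => LynF w ∧ srfLen (List.ofFn w) ≤ K) ∧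
    n * cnt (fun w : Fin n → Fin q => LynF w ∧ srfLen (List.ofFn w) ≤ K) ≤
      cnt (fun w : Fin n → Fin q => Gd L w ∧ n - Dd L w ≤ K) +
      cnt (fun w : Fin n → Fin q => ¬ Gd L w) := by
  have h1 := card_D (n := n) (q := q) L hn (fun d => n - d ≤ K)
  have h2 := card_lyn_notG (n := n) (q := q) L
  rw [cnt_eq, cnt_eq] at h1 h2
  have h3 := cnt_split (fun w : Fin n → Fin q => LynF w ∧ srfLen (List.ofFn w) ≤ K)
    (fun w => Gd L w)
  have h6 : cnt (fun w : Fin n → Fin q => (LynF w ∧ srfLen (List.ofFn w) ≤ K) ∧ Gd L w) =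
      cnt (fun w : Fin n → Fin q => Gd L w ∧ (tp L w).1 = 0 ∧ n - (tp L w).2 ≤ K) := by
    apply cnt_congr
    intro w
    constructor
    · rintro ⟨⟨a, c⟩, b⟩
      have h0 := p1_of_lynF hn b a
      rw [srf_eq hn b h0] at c
      exact ⟨b, h0, c⟩
    · rintro ⟨b, a, c⟩
      refine ⟨⟨lynF_of_p1 hn b a, ?_⟩, b⟩
      rwa [srf_eq hn b a]
  have h7 : cnt (fun w : Fin n → Fin q => (LynF w ∧ srfLen (List.ofFn w) ≤ K) ∧ ¬ Gd L w) ≤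
      cnt (fun w : Fin n → Fin q => LynF w ∧ ¬ Gd L w) :=
    cnt_mono fun w hw => ⟨hw.1.1, hw.2⟩
  have h8 := Nat.mul_le_mul_left n h7
  rw [h3, Nat.mul_add, h6]
  omega

/-- Arithmetic of arcs. -/
lemma arc_same {m p p' : ℕ} (hm : 0 < m) (hp : p < n) (hp' : p' < n) (hne : p ≠ p')
    (h : p / m = p' / m) : (p' + n - p) % n < m ∨ n < (p' + n - p) % n + m := by
  have e1 := Nat.div_add_mod p m
  have e2 := Nat.div_add_mod p' m
  have m1 := Nat.mod_lt p hm
  have m2 := Nat.mod_lt p' hm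
  rw [h] at e1
  rcases lt_or_gt_of_ne hne with hl | hl
  · left
    rw [show p' + n - p = (p' - p) + n by omega, Nat.add_mod_right, Nat.mod_eq_of_lt (by omega)]
    omega
  · right
    rw [Nat.mod_eq_of_lt (by omega)]
    omega

lemma arc_one {M L m p p' : ℕ} (hm : 0 < m) (hM : M * m ≤ n) (hL : 2 ≤ L) (hp : Inn M L m p)
    (hp' : p' < n) (h : (p' + n - p) % n = 1) : p / m = p' / m := by
  have h1 := inn_add hm hp (t := 1) (by omega)
  have h2 : p + 1 < n := lt_of_div hm hM (by rw [h1.1]; exact hp.1)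
  have : p' = p + 1 := by
    rcases Nat.lt_or_ge p' p with hl | hl
    · rw [Nat.mod_eq_of_lt (by omega)] at h
      omega
    · rw [show p' + n - p = (p' - p) + n by omega, Nat.add_mod_right,
        Nat.mod_eq_of_lt (by omega)] at h
      omega
  rw [this, h1.1]

lemma arc_diff {M m p p' : ℕ} (hm : 0 < m) (hM : M * m ≤ n) (hM' : n < M * m + m)
    (ha : p / m < M) (hb : p' / m < M) (hne : p / m ≠ p' / m) :
    n - (p' + n - p) % n < ((p / m + M - p' / m) % M + 2) * m ∧
    ((p / m + M - p' / m) % M) * m < n - (p' + n - p) % n + m := by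
  have hp : p < n := lt_of_div hm hM ha
  have hp' : p' < n := lt_of_div hm hM hb
  have e1 := Nat.div_add_mod' p m
  have e2 := Nat.div_add_mod' p' m
  have m1 := Nat.mod_lt p hm
  have m2 := Nat.mod_lt p' hm
  generalize p / m = a at *
  generalize p' / m = b at *
  generalize p % m = i at *
  generalize p' % m = j at *
  rcases lt_or_gt_of_ne hne with hl | hl
  · obtain ⟨d, rfl⟩ := Nat.exists_eq_add_of_lt hl
    obtain ⟨c, rfl⟩ := Nat.exists_eq_add_of_lt hb
    have hc : (a + (a + d + 1 + c + 1) - (a + d + 1)) % (a + d + 1 + c + 1) = a + c + 1 := by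
      rw [show a + (a + d + 1 + c + 1) - (a + d + 1) = a + c + 1 by omega,
        Nat.mod_eq_of_lt (by omega)]
    have hpp : p < p' := by
      rw [← e1, ← e2]; nlinarith
    rw [hc, show p' + n - p = (p' - p) + n by omega, Nat.add_mod_right,
      Nat.mod_eq_of_lt (by omega)]
    have hs : ∀ z, (z + 1) * m = z * m + m := fun z => by ring
    have hd : ∀ y z, (y + z) * m = y * m + z * m := fun y z => by ring
    simp only [hd, one_mul] at *
    omega
  · obtain ⟨d, rfl⟩ := Nat.exists_eq_add_of_lt hl
    have hc : (b + d + 1 + M - b) % M = d + 1 := by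
      rw [show b + d + 1 + M - b = d + 1 + M by omega, Nat.add_mod_right,
        Nat.mod_eq_of_lt (by omega)]
    have hpp : p' < p := by
      rw [← e1, ← e2]; nlinarith
    rw [hc, Nat.mod_eq_of_lt (by omega)]
    have hd : ∀ y z, (y + z) * m = y * m + z * m := fun y z => by ring
    simp only [hd, one_mul] at *
    omega

/-- Good words with extremal positions in distinct arcs. -/
lemma avg' {M L m : ℕ} (hn : 2 ≤ n) (hm : 0 < m) (hM : M * m ≤ n) (t : ℕ) (ht : t < M)
    (hM2 : 2 ≤ M) :
    cnt (fun w : Fin n → Fin q => Hh M L m w ∧ (tp L w).1 / m ≠ (tp L w).2 / m ∧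
      ((tp L w).1 / m + M - (tp L w).2 / m) % M ≤ t) * (M - 1) ≤
    cnt (fun w : Fin n → Fin q => Hh M L m w ∧ (tp L w).1 / m ≠ (tp L w).2 / m) * t +
      cnt (fun w : Fin n → Fin q => ¬ Hh M L m w) * (M - 1) ∧
    cnt (fun w : Fin n → Fin q => Hh M L m w ∧ (tp L w).1 / m ≠ (tp L w).2 / m) * t ≤
    cnt (fun w : Fin n → Fin q => Hh M L m w ∧ (tp L w).1 / m ≠ (tp L w).2 / m ∧
      ((tp L w).1 / m + M - (tp L w).2 / m) % M ≤ t) * (M - 1) +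
      cnt (fun w : Fin n → Fin q => ¬ Hh M L m w) * (M - 1) := by
  have := averaging (n := n) (q := q) (M := M) (L := L) hn hm hM
    (fun a b => (a + M - b) % M ≤ t) _ _ _ _ rfl rfl rfl rfl
  rw [cnt_eq, cnt_eq, cnt_eq] at this
  have hT : ((Finset.univ : Finset (Fin M)).offDiag.filter
      fun p => (p.1.val + M - p.2.val) % M ≤ t).card = M * t := card_T t ht
  have hT' : ∀ D : DecidablePred (fun p : Fin M × Fin M => (p.1.val + M - p.2.val) % M ≤ t),
    (@Finset.filter _ (fun p : Fin M × Fin M => (p.1.val + M - p.2.val) % M ≤ t) D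
      (Finset.univ : Finset (Fin M)).offDiag).card = M * t := by
    intro D
    rw [← hT]
    congr
  rw [hT', show M * M - M = M * (M - 1) by rw [Nat.mul_sub, mul_one]] at this
  obtain ⟨a, b⟩ := this
  constructor
  · refine Nat.le_of_mul_le_mul_left (?_ : M * _ ≤ M * _) (by omega)
    calc _ = _ := Nat.mul_left_comm _ _ _
      _ ≤ _ := a
      _ = _ := by ring
  · refine Nat.le_of_mul_le_mul_left (?_ : M * _ ≤ M * _) (by omega)
    calc _ = _ := Nat.mul_left_comm _ _ _
      _ ≤ _ := b
      _ = _ := by ring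

end

section

variable {N q : ℕ} [NeZero N]

lemma adj_bounds (L k : ℕ) (hq : 0 < q) (hN : 2 ≤ N) (hL : 1 ≤ L) (hk : 0 < k) :
    cnt (fun w : Fin (N + 1) → Fin q => Gd L w ∧ Dd L w = 1) ≤
      (N + 1) * cnt (fun w : Fin N → Fin q => LynF w) +
        cnt (fun w : Fin (N + 1) → Fin q => NoRun k w) ∧
    (N + 1) * cnt (fun w : Fin N → Fin q => LynF w) ≤
      cnt (fun w : Fin (N + 1) → Fin q => Gd L w ∧ Dd L w = 1) +
      cnt (fun w : Fin (N + 1) → Fin q => ¬ Gd L w) := by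
  have h1 := card_D (n := N + 1) (q := q) L (by omega) (fun d => d = 1)
  have h2 := card_lyn_notG (n := N + 1) (q := q) L
  have h3 := card_lyn_nozero (n := N + 1) (q := q)
  have h4 := card_adj_le (q := q) hL hN
  have h5 := card_adj_ge (q := q) (L := L) hq hN
  rw [cnt_eq, cnt_eq] at h1 h2 h3
  rw [cnt_eq, cnt_eq, cnt_eq] at h4 h5
  have h6 : cnt (fun w : Fin (N + 1) → Fin q => ∀ i, cw w i ≠ 0) ≤
      cnt (fun w : Fin (N + 1) → Fin q => NoRun k w) :=
    cnt_mono fun w hw i => ⟨0, hk, hw _⟩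
  have h7 := Nat.mul_le_mul_left (N + 1) h4
  have h8 := Nat.mul_le_mul_left (N + 1) h5
  rw [Nat.mul_add] at h7 h8
  omega

end

end LynAux

namespace LynAux

section

variable {N q : ℕ} [NeZero N]

lemma core (L m M k K : ℕ) (e : ℝ) (hq : 0 < q) (hN : 2 ≤ N) (hL : 2 ≤ L) (hm : 0 < m)
    (hM : M * m ≤ N + 1) (hM' : N + 1 < M * m + m) (hM2 : 2 ≤ M) (hK : K < N) (hKM : K / m + 1 < M)
    (hG : (cnt (fun w : Fin (N + 1) → Fin q => ¬ Gd L w) : ℝ) ≤ e * q ^ (N + 1))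
    (hh : (cnt (fun w : Fin (N + 1) → Fin q => ¬ Hh M L m w) : ℝ) ≤ e * q ^ (N + 1))
    (hC : (cnt (fun w : Fin (N + 1) → Fin q => (Gd L w ∧ Dd L w ≠ 1 ∧
      (Dd L w < m ∨ N + 1 < Dd L w + m)) ∧ ¬ NoRun (k + 1) w) : ℝ) ≤ e * q ^ (N + 1))
    (hR : (cnt (fun w : Fin (N + 1) → Fin q => NoRun (k + 1) w) : ℝ) ≤ e * q ^ (N + 1)) :
    (((N + 1) * cnt (fun w : Fin (N + 1) → Fin q => LynF w ∧ srfLen (List.ofFn w) ≤ K) : ℕ) : ℝ)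
      * ((M : ℝ) - 1) ≤
      ((q : ℝ) ^ (N + 1) - ((N + 1) * cnt (fun w : Fin N → Fin q => LynF w) : ℕ)
        + e * q ^ (N + 1)) * ((K / m + 1 : ℕ) : ℝ) + 5 * e * q ^ (N + 1) * ((M : ℝ) - 1) ∧
    ((q : ℝ) ^ (N + 1) - ((N + 1) * cnt (fun w : Fin N → Fin q => LynF w) : ℕ)
        - 4 * e * q ^ (N + 1)) * ((K / m - 2 : ℕ) : ℝ) - e * q ^ (N + 1) * ((M : ℝ) - 1) ≤
    (((N + 1) * cnt (fun w : Fin (N + 1) → Fin q => LynF w ∧ srfLen (List.ofFn w) ≤ K) : ℕ) : ℝ)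
      * ((M : ℝ) - 1) := by
  have hn : 2 ≤ N + 1 := by omega
  have hMr : (0 : ℝ) ≤ (M : ℝ) - 1 := by
    have : (2 : ℝ) ≤ M := by exact_mod_cast hM2
    linarith
  have hMc : ((M - 1 : ℕ) : ℝ) = (M : ℝ) - 1 := by
    rw [Nat.cast_sub (by omega), Nat.cast_one]
  -- the basic counts
  obtain ⟨n1, n2⟩ := num_bounds (n := N + 1) (q := q) L K hn
  obtain ⟨a1, a2⟩ := adj_bounds (N := N) (q := q) L (k + 1) hq hN (by omega) (by omega)
  have s1 := cnt_not (fun w : Fin (N + 1) → Fin q => Hh M L m w)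
  have s2 := cnt_split (fun w : Fin (N + 1) → Fin q => Hh M L m w)
    (fun w => (tp L w).1 / m ≠ (tp L w).2 / m)
  -- words whose extremal positions lie in the same arc
  have hclose : ∀ w : Fin (N + 1) → Fin q, Hh M L m w → (tp L w).1 / m = (tp L w).2 / m →
      (Dd L w < m ∨ N + 1 < Dd L w + m) := by
    intro w hw he
    obtain ⟨b1, b2, b3, _⟩ := tp_spec L w hn
    exact arc_same hm b1 b2 b3 he
  have u1 : cnt (fun w : Fin (N + 1) → Fin q => Hh M L m w ∧
      ¬ (tp L w).1 / m ≠ (tp L w).2 / m) ≤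
      cnt (fun w : Fin (N + 1) → Fin q => Gd L w ∧ Dd L w = 1) +
      (cnt (fun w : Fin (N + 1) → Fin q => (Gd L w ∧ Dd L w ≠ 1 ∧
        (Dd L w < m ∨ N + 1 < Dd L w + m)) ∧ ¬ NoRun (k + 1) w) +
       cnt (fun w : Fin (N + 1) → Fin q => NoRun (k + 1) w)) := by
    have v : cnt (fun w : Fin (N + 1) → Fin q => Hh M L m w ∧
        ¬ (tp L w).1 / m ≠ (tp L w).2 / m) ≤
        cnt (fun w : Fin (N + 1) → Fin q => Gd L w ∧ Dd L w = 1) +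
        cnt (fun w : Fin (N + 1) → Fin q => (Gd L w ∧ Dd L w ≠ 1 ∧
        (Dd L w < m ∨ N + 1 < Dd L w + m))) := by
      apply cnt_le_add
      rintro w ⟨hw, he⟩
      have := hclose w hw (not_not.1 he)
      by_cases h1 : Dd L w = 1
      · exact Or.inl ⟨hw.1, h1⟩
      · exact Or.inr ⟨hw.1, h1, this⟩
    refine v.trans (Nat.add_le_add_left ?_ _)
    apply cnt_le_add
    intro w hw
    by_cases h1 : NoRun (k + 1) w
    · exact Or.inr h1
    · exact Or.inl ⟨hw, h1⟩
  have u2 : cnt (fun w : Fin (N + 1) → Fin q => Gd L w ∧ Dd L w = 1) ≤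
      cnt (fun w : Fin (N + 1) → Fin q => Hh M L m w ∧ ¬ (tp L w).1 / m ≠ (tp L w).2 / m) +
      cnt (fun w : Fin (N + 1) → Fin q => ¬ Hh M L m w) := by
    apply cnt_le_add
    rintro w ⟨hw, he⟩
    by_cases h1 : Hh M L m w
    · left
      refine ⟨h1, not_not.2 ?_⟩
      exact arc_one hm hM hL h1.2.1 (tp_spec L w hn).2.1 he
    · exact Or.inr h1
  -- upper bound
  have w1 : cnt (fun w : Fin (N + 1) → Fin q => Gd L w ∧ N + 1 - Dd L w ≤ K) ≤
      cnt (fun w : Fin (N + 1) → Fin q => Hh M L m w ∧ (tp L w).1 / m ≠ (tp L w).2 / m ∧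
        ((tp L w).1 / m + M - (tp L w).2 / m) % M ≤ K / m + 1) +
      (cnt (fun w : Fin (N + 1) → Fin q => ¬ Hh M L m w) +
      (cnt (fun w : Fin (N + 1) → Fin q => (Gd L w ∧ Dd L w ≠ 1 ∧
        (Dd L w < m ∨ N + 1 < Dd L w + m)) ∧ ¬ NoRun (k + 1) w) +
       cnt (fun w : Fin (N + 1) → Fin q => NoRun (k + 1) w))) := by
    have v : cnt (fun w : Fin (N + 1) → Fin q => Gd L w ∧ N + 1 - Dd L w ≤ K) ≤
      cnt (fun w : Fin (N + 1) → Fin q => Hh M L m w ∧ (tp L w).1 / m ≠ (tp L w).2 / m ∧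
        ((tp L w).1 / m + M - (tp L w).2 / m) % M ≤ K / m + 1) +
        cnt (fun w : Fin (N + 1) → Fin q => ¬ Hh M L m w ∨ (((Gd L w ∧ Dd L w ≠ 1 ∧
        (Dd L w < m ∨ N + 1 < Dd L w + m)) ∧ ¬ NoRun (k + 1) w) ∨ NoRun (k + 1) w)) := by
      apply cnt_le_add
      rintro w ⟨hw, he⟩
      by_cases h1 : Hh M L m w
      · by_cases h2 : (tp L w).1 / m = (tp L w).2 / m
        · right; right
          by_cases h3 : NoRun (k + 1) w
          · exact Or.inr h3
          · exact Or.inl ⟨⟨hw, by omega, hclose w h1 h2⟩, h3⟩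
        · left
          refine ⟨h1, h2, ?_⟩
          have h3 := (arc_diff hm hM hM' h1.2.1.1 h1.2.2.1 h2).2
          unfold Dd at he
          have h4 : ((tp L w).1 / m + M - (tp L w).2 / m) % M * m < K + m :=
            lt_of_lt_of_le h3 (by omega)
          have h5 : K < (K / m + 1) * m := by
            have := Nat.lt_div_mul_add (a := K) hm
            nlinarith
          have h6 : ((tp L w).1 / m + M - (tp L w).2 / m) % M * m < (K / m + 2) * m := by
            nlinarith
          have := Nat.lt_of_mul_lt_mul_right h6
          omega
      · right; left; exact h1
    refine v.trans (Nat.add_le_add_left ?_ _)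
    refine (cnt_le_add fun w hw => hw).trans (Nat.add_le_add_left ?_ _)
    exact cnt_le_add fun w hw => hw
  -- lower bound
  have w2 : 2 ≤ K / m → cnt (fun w : Fin (N + 1) → Fin q => Hh M L m w ∧
        (tp L w).1 / m ≠ (tp L w).2 / m ∧
        ((tp L w).1 / m + M - (tp L w).2 / m) % M ≤ K / m - 2) ≤
      cnt (fun w : Fin (N + 1) → Fin q => Gd L w ∧ N + 1 - Dd L w ≤ K) := by
    intro h2
    apply cnt_mono
    rintro w ⟨h1, hne, hle⟩
    refine ⟨h1.1, ?_⟩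
    have h3 := (arc_diff hm hM hM' h1.2.1.1 h1.2.2.1 hne).1
    unfold Dd
    refine (h3.le.trans (Nat.mul_le_mul_right m (?_ : _ ≤ K / m))).trans (Nat.div_mul_le_self K m)
    omega
  have A1 := (avg' (n := N + 1) (q := q) (L := L) hn hm hM (K / m + 1) hKM hM2).1
  have A2 := (avg' (n := N + 1) (q := q) (L := L) hn hm hM (K / m - 2) (by omega) hM2).2
  -- move to real numbers
  generalize cnt (fun w : Fin (N + 1) → Fin q => LynF w ∧ srfLen (List.ofFn w) ≤ K) = num at *
  generalize cnt (fun w : Fin N → Fin q => LynF w) = ell at *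
  generalize cnt (fun w : Fin (N + 1) → Fin q => Gd L w ∧ N + 1 - Dd L w ≤ K) = E at *
  generalize cnt (fun w : Fin (N + 1) → Fin q => ¬ Gd L w) = G at *
  generalize cnt (fun w : Fin (N + 1) → Fin q => ¬ Hh M L m w) = h at *
  generalize cnt (fun w : Fin (N + 1) → Fin q => (Gd L w ∧ Dd L w ≠ 1 ∧
        (Dd L w < m ∨ N + 1 < Dd L w + m)) ∧ ¬ NoRun (k + 1) w) = C at *
  generalize cnt (fun w : Fin (N + 1) → Fin q => NoRun (k + 1) w) = R at *
  generalize cnt (fun w : Fin (N + 1) → Fin q => Gd L w ∧ Dd L w = 1) = A at *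
  generalize cnt (fun w : Fin (N + 1) → Fin q => Hh M L m w) = H at *
  generalize cnt (fun w : Fin (N + 1) → Fin q => Hh M L m w ∧
    ¬ (tp L w).1 / m ≠ (tp L w).2 / m) = S at *
  generalize cnt (fun w : Fin (N + 1) → Fin q => Hh M L m w ∧
    (tp L w).1 / m ≠ (tp L w).2 / m) = Z at *
  generalize cnt (fun w : Fin (N + 1) → Fin q => Hh M L m w ∧ (tp L w).1 / m ≠ (tp L w).2 / m ∧
        ((tp L w).1 / m + M - (tp L w).2 / m) % M ≤ K / m + 1) = X1 at *
  generalize cnt (fun w : Fin (N + 1) → Fin q => Hh M L m w ∧ (tp L w).1 / m ≠ (tp L w).2 / m ∧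
        ((tp L w).1 / m + M - (tp L w).2 / m) % M ≤ K / m - 2) = X2 at *
  generalize (N + 1) * num = nu at *
  generalize (N + 1) * ell = el at *
  have Zle : (Z : ℝ) ≤ (q : ℝ) ^ (N + 1) - el + e * q ^ (N + 1) := by
    have e1 : Z + el ≤ q ^ (N + 1) + G := by omega
    have e2 : (Z : ℝ) + el ≤ (q : ℝ) ^ (N + 1) + G := by exact_mod_cast e1
    linarith
  have Zge : (q : ℝ) ^ (N + 1) - el - 4 * e * q ^ (N + 1) ≤ (Z : ℝ) := by
    have e1 : q ^ (N + 1) ≤ Z + el + h + C + 2 * R := by omega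
    have e2 : (q : ℝ) ^ (N + 1) ≤ (Z : ℝ) + el + h + C + 2 * R := by exact_mod_cast e1
    linarith
  have B1 : (X1 : ℝ) * ((M : ℝ) - 1) ≤ Z * ((K / m + 1 : ℕ) : ℝ) + h * ((M : ℝ) - 1) := by
    rw [← hMc]; exact_mod_cast A1
  have B2 : (Z : ℝ) * ((K / m - 2 : ℕ) : ℝ) ≤ X2 * ((M : ℝ) - 1) + h * ((M : ℝ) - 1) := by
    rw [← hMc]; exact_mod_cast A2
  have hGn : (0 : ℝ) ≤ e * q ^ (N + 1) := (Nat.cast_nonneg G).trans hG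
  constructor
  · have e1 : nu ≤ X1 + h + C + R + G := by omega
    have e2 : (nu : ℝ) ≤ X1 + h + C + R + G := by exact_mod_cast e1
    have e3 : (nu : ℝ) ≤ X1 + 4 * (e * q ^ (N + 1)) := by linarith
    have e4 := mul_le_mul_of_nonneg_right e3 hMr
    have e5 := mul_le_mul_of_nonneg_right Zle (Nat.cast_nonneg (α := ℝ) (K / m + 1))
    have e6 := mul_le_mul_of_nonneg_right hh hMr
    linarith
  · rcases Nat.lt_or_ge (K / m) 2 with hlt | hge
    · rw [Nat.sub_eq_zero_of_le hlt.le, Nat.cast_zero, mul_zero, zero_sub]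
      have := mul_nonneg hGn hMr
      have := mul_nonneg (Nat.cast_nonneg (α := ℝ) nu) hMr
      linarith
    · have e1 : X2 ≤ nu := (w2 hge).trans n1
      have e2 : (X2 : ℝ) ≤ nu := by exact_mod_cast e1
      have e4 := mul_le_mul_of_nonneg_right e2 hMr
      have e5 := mul_le_mul_of_nonneg_right Zge (Nat.cast_nonneg (α := ℝ) (K / m - 2))
      have e6 := mul_le_mul_of_nonneg_right hh hMr
      linarith

end

end LynAux

namespace LynAux

open Filter Topology

section

lemma lim1 : Tendsto (fun s : ℕ => ((s : ℝ) + 1) ^ 16 / 2 ^ s) atTop (𝓝 0) := by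
  have h := tendsto_pow_const_div_const_pow_of_one_lt 16 (r := (2 : ℝ)) (by norm_num)
  have h2 := (h.comp (tendsto_add_atTop_nat 1)).const_mul 2
  rw [mul_zero] at h2
  refine h2.congr fun s => ?_
  simp only [Function.comp, Nat.cast_add, Nat.cast_one, pow_succ (2 : ℝ) s]
  field_simp

lemma lim2 : Tendsto (fun s : ℕ => 4 / (s : ℝ) ^ 3) atTop (𝓝 0) :=
  Tendsto.const_div_atTop ((tendsto_pow_atTop (by norm_num)).comp tendsto_natCast_atTop_atTop) _

lemma lim3 (c : ℝ) (hc : 0 ≤ c) :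
    Tendsto (fun s : ℕ => c * ((s : ℝ) + 1) ^ 8 * s ^ 4 / s ^ 14) atTop (𝓝 0) := by
  have h : Tendsto (fun s : ℕ => c * 2 ^ 8 / (s : ℝ) ^ 2) atTop (𝓝 0) :=
    Tendsto.const_div_atTop
      ((tendsto_pow_atTop (by norm_num)).comp tendsto_natCast_atTop_atTop) _
  refine tendsto_of_tendsto_of_tendsto_of_le_of_le' tendsto_const_nhds h ?_ ?_
  · exact Eventually.of_forall fun s => by positivity
  · filter_upwards [eventually_ge_atTop 1] with s hs
    have h1 : (1 : ℝ) ≤ s := by exact_mod_cast hs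
    rw [div_le_div_iff₀ (by positivity) (by positivity)]
    have h2 : ((s : ℝ) + 1) ^ 8 ≤ (2 * s) ^ 8 := by
      apply pow_le_pow_left₀ (by positivity)
      linarith
    calc c * ((s : ℝ) + 1) ^ 8 * s ^ 4 * s ^ 2 = ((s : ℝ) + 1) ^ 8 * (c * s ^ 6) := by ring
      _ ≤ (2 * s) ^ 8 * (c * s ^ 6) := by gcongr
      _ = _ := by ring

lemma lim4 : Tendsto (fun s : ℕ => 7 / Real.log 2 * (Real.log s / s)) atTop (𝓝 0) := by
  have h := Real.isLittleO_log_id_atTop.tendsto_div_nhds_zero.comp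
    (tendsto_natCast_atTop_atTop (R := ℝ))
  have h2 := h.const_mul (7 / Real.log 2)
  rw [mul_zero] at h2
  exact h2

lemma log_bound {q s : ℕ} (hq : 2 ≤ q) (hs : 1 ≤ s) :
    (Nat.log q (s ^ 7) : ℝ) ≤ 7 / Real.log 2 * Real.log s := by
  have h1 : (2 : ℝ) ^ (Nat.log q (s ^ 7)) ≤ (s : ℝ) ^ 7 := by
    have := Nat.pow_log_le_self q (x := s ^ 7) (by positivity)
    have h2 := (Nat.pow_le_pow_left hq (Nat.log q (s ^ 7))).trans this
    exact_mod_cast h2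
  have h2 := Real.log_le_log (by positivity) h1
  rw [Real.log_pow, Real.log_pow] at h2
  have h3 : 0 < Real.log 2 := Real.log_pos (by norm_num)
  rw [div_mul_eq_mul_div, le_div_iff₀ h3]
  exact_mod_cast h2

lemma bern (a : ℝ) (h0 : 0 ≤ a) (h1 : a ≤ 1) (B : ℕ) : (1 - a) ^ B * (1 + B * a) ≤ 1 := by
  have h2 : 1 + B * a ≤ (1 + a) ^ B := one_add_mul_le_pow (by linarith) B
  calc (1 - a) ^ B * (1 + B * a) ≤ (1 - a) ^ B * (1 + a) ^ B := by
        apply mul_le_mul_of_nonneg_left h2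
        apply pow_nonneg; linarith
    _ = (1 - a ^ 2) ^ B := by rw [← mul_pow]; ring_nf
    _ ≤ 1 := by
        apply pow_le_one₀
        · nlinarith
        · nlinarith

lemma exists_root (n : ℕ) : ∃ s : ℕ, s ^ 8 ≤ n ∧ n < (s + 1) ^ 8 := by
  refine ⟨Nat.findGreatest (fun s => s ^ 8 ≤ n) n, ?_, ?_⟩
  · exact Nat.findGreatest_spec (P := fun s => s ^ 8 ≤ n) (Nat.zero_le n) (by simp)
  · by_contra h
    rw [not_lt] at h
    have h1 : Nat.findGreatest (fun s => s ^ 8 ≤ n) n + 1 ≤ n :=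
      (Nat.le_self_pow (by norm_num) _).trans h
    have := Nat.le_findGreatest (P := fun s => s ^ 8 ≤ n) h1 h
    omega

/-- Bounds for the four exceptional sets. -/
structure Bds (q n L m k : ℕ) (e : ℝ) [NeZero n] : Prop where
  hm : 0 < m
  hL : 2 ≤ L
  hG : (cnt (fun w : Fin n → Fin q => ¬ Gd L w) : ℝ) ≤ e * q ^ n
  hh : (cnt (fun w : Fin n → Fin q => ¬ Hh (n / m) L m w) : ℝ) ≤ e * q ^ n
  hC : (cnt (fun w : Fin n → Fin q => (Gd L w ∧ Dd L w ≠ 1 ∧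
      (Dd L w < m ∨ n < Dd L w + m)) ∧ ¬ NoRun (k + 1) w) : ℝ) ≤ e * q ^ n
  hR : (cnt (fun w : Fin n → Fin q => NoRun (k + 1) w) : ℝ) ≤ e * q ^ n

/-- The error term. -/
noncomputable def err (q s : ℕ) : ℝ :=
  ((s : ℝ) + 1) ^ 16 / 2 ^ s + 4 / (s : ℝ) ^ 3 +
    (2 * q ^ 4 * ((s : ℝ) + 1) ^ 8 * s ^ 4 / s ^ 14) + 7 / Real.log 2 * (Real.log s / s)

lemma err_lim (q : ℕ) : Tendsto (err q) atTop (𝓝 0) := by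
  have := ((lim1.add lim2).add (lim3 (2 * (q : ℝ) ^ 4) (by positivity))).add lim4
  simp only [add_zero] at this
  exact this

lemma bds {q n s : ℕ} [NeZero n] (hq : 2 ≤ q) (h1 : s ^ 8 ≤ n) (h2 : n < (s + 1) ^ 8)
    (hs : 2 ≤ s) (hlog : Nat.log q (s ^ 7) ≤ s) (hlog1 : 1 ≤ Nat.log q (s ^ 7)) :
    Bds q n s (s ^ 4) (Nat.log q (s ^ 7) - 1) (err q s) := by
  have hsr : (2 : ℝ) ≤ s := by exact_mod_cast hs
  have hs0 : (0 : ℝ) < s := by linarith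
  have hqr : (2 : ℝ) ≤ q := by exact_mod_cast hq
  have hQ : (0 : ℝ) < (q : ℝ) ^ n := by positivity
  have n1 : (s : ℝ) ^ 8 ≤ n := by exact_mod_cast h1
  have n2 : (n : ℝ) ≤ ((s : ℝ) + 1) ^ 8 := by exact_mod_cast h2.le
  have hn0 : (0 : ℝ) < n := lt_of_lt_of_le (by positivity) n1
  have hs2 : 2 * s ≤ s ^ 8 := by
    calc 2 * s ≤ s * s := Nat.mul_le_mul_right _ hs
      _ = s ^ 2 := by ring
      _ ≤ s ^ 8 := Nat.pow_le_pow_right (by omega) (by norm_num)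
  have hn2 : 2 ≤ n := by omega
  have hm : 0 < s ^ 4 := by positivity
  have p1 : 0 ≤ ((s : ℝ) + 1) ^ 16 / 2 ^ s := by positivity
  have p2 : 0 ≤ 4 / (s : ℝ) ^ 3 := by positivity
  have p3 : 0 ≤ (2 * q ^ 4 * ((s : ℝ) + 1) ^ 8 * s ^ 4 / s ^ 14) := by positivity
  have p4 : 0 ≤ 7 / Real.log 2 * (Real.log s / s) := by
    have : 0 ≤ Real.log s := Real.log_nonneg (by linarith)
    have : 0 < Real.log 2 := Real.log_pos (by norm_num)
    positivity
  have bG : (cnt (fun w : Fin n → Fin q => ¬ Gd s w) : ℝ) ≤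
      (((s : ℝ) + 1) ^ 16 / 2 ^ s) * q ^ n := by
    have h := card_not_Gd (n := n) (q := q) s (by omega)
    rw [cnt_eq] at h
    have h' : (cnt (fun w : Fin n → Fin q => ¬ Gd s w) : ℝ) * q ^ s ≤ (n : ℝ) ^ 2 * q ^ n := by
      exact_mod_cast h
    rw [div_mul_eq_mul_div, le_div_iff₀ (by positivity)]
    calc _ ≤ (cnt (fun w : Fin n → Fin q => ¬ Gd s w) : ℝ) * q ^ s := by gcongr
      _ ≤ (n : ℝ) ^ 2 * q ^ n := h'
      _ ≤ (((s : ℝ) + 1) ^ 8) ^ 2 * q ^ n := by gcongr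
      _ = _ := by ring
  have hk1 : Nat.log q (s ^ 7) - 1 + 1 = Nat.log q (s ^ 7) := by omega
  refine ⟨hm, hs, ?_, ?_, ?_, ?_⟩
  · refine bG.trans (mul_le_mul_of_nonneg_right ?_ hQ.le)
    unfold err; linarith
  · have h := card_not_H (n := n) (q := q) (M := n / s ^ 4) s (s ^ 4) hn2 hm
      (Nat.le_self_pow (by norm_num) s)
    rw [cnt_eq, cnt_eq] at h
    set M := n / s ^ 4 with hMd
    have hM1 : M * s ^ 4 ≤ n := Nat.div_mul_le_self _ _
    have hM2 : n - M * s ^ 4 ≤ s ^ 4 := by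
      have := Nat.lt_div_mul_add (a := n) hm
      rw [← hMd] at this
      omega
    have h' : n * cnt (fun w : Fin n → Fin q => ¬ Hh M s (s ^ 4) w) ≤
        n * cnt (fun w : Fin n → Fin q => ¬ Gd s w) + 2 * (M * s + s ^ 4) * q ^ n := by
      refine h.trans ?_
      gcongr
    have h'' : (n : ℝ) * cnt (fun w : Fin n → Fin q => ¬ Hh M s (s ^ 4) w) ≤
        n * cnt (fun w : Fin n → Fin q => ¬ Gd s w) + 2 * (M * s + s ^ 4) * q ^ n := by
      exact_mod_cast h'
    have hM3 : (M : ℝ) * s ^ 4 ≤ n := by exact_mod_cast hM1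
    have key : 2 * ((M : ℝ) * s + s ^ 4) ≤ n * (4 / (s : ℝ) ^ 3) := by
      rw [mul_div_assoc', le_div_iff₀ (by positivity)]
      have a1 : (s : ℝ) ^ 7 ≤ s ^ 8 := pow_le_pow_right₀ (by linarith) (by norm_num)
      nlinarith
    have key2 : (cnt (fun w : Fin n → Fin q => ¬ Hh M s (s ^ 4) w) : ℝ) ≤
        (((s : ℝ) + 1) ^ 16 / 2 ^ s) * q ^ n + (4 / (s : ℝ) ^ 3) * q ^ n := by
      apply le_of_mul_le_mul_left _ hn0
      calc _ ≤ _ := h''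
        _ ≤ n * ((((s : ℝ) + 1) ^ 16 / 2 ^ s) * q ^ n) + (n * (4 / (s : ℝ) ^ 3)) * q ^ n := by
          gcongr
        _ = _ := by ring
    refine key2.trans ?_
    rw [← add_mul]
    refine mul_le_mul_of_nonneg_right ?_ hQ.le
    unfold err; linarith
  · have h := card_close (n := n) (q := q) s (Nat.log q (s ^ 7) - 1) (s ^ 4) (by omega) hn2
    rw [cnt_eq] at h
    set k := Nat.log q (s ^ 7) - 1 with hk
    generalize cnt (fun w : Fin n → Fin q => (Gd s w ∧ Dd s w ≠ 1 ∧
      (Dd s w < s ^ 4 ∨ n < Dd s w + s ^ 4)) ∧ ¬ NoRun (k + 1) w) = C at *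
    have h' : (C : ℝ) * q ^ (2 * k) ≤ 2 * n * s ^ 4 * q ^ n := by exact_mod_cast h
    have hp : s ^ 7 ≤ q ^ (k + 2) := by
      have := Nat.lt_pow_succ_log_self (b := q) (by omega) (s ^ 7)
      rw [← hk1] at this
      exact this.le
    have hp' : (s : ℝ) ^ 7 ≤ (q : ℝ) ^ (k + 2) := by exact_mod_cast hp
    have key : (C : ℝ) ≤ (2 * q ^ 4 * ((s : ℝ) + 1) ^ 8 * s ^ 4 / s ^ 14) * q ^ n := by
      rw [div_mul_eq_mul_div, le_div_iff₀ (by positivity)]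
      calc (C : ℝ) * s ^ 14 = C * (s ^ 7) ^ 2 := by ring
        _ ≤ C * ((q : ℝ) ^ (k + 2)) ^ 2 := by gcongr
        _ = (C * q ^ (2 * k)) * q ^ 4 := by ring
        _ ≤ (2 * n * s ^ 4 * q ^ n) * q ^ 4 := by gcongr
        _ ≤ (2 * ((s : ℝ) + 1) ^ 8 * s ^ 4 * q ^ n) * q ^ 4 := by gcongr
        _ = _ := by ring
    refine key.trans (mul_le_mul_of_nonneg_right ?_ hQ.le)
    unfold err; linarith
  · rw [hk1]
    set k := Nat.log q (s ^ 7) with hk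
    set B := n / k with hB
    have hBk : B * k ≤ n := Nat.div_mul_le_self _ _
    have h := card_noRun (n := n) (q := q) k B (by omega) (by omega) hBk
    rw [cnt_eq] at h
    generalize cnt (fun w : Fin n → Fin q => NoRun k w) = R at *
    have hqk : (0 : ℝ) < (q : ℝ) ^ k := by positivity
    have hq1 : 1 ≤ q ^ k := Nat.one_le_pow _ _ (by omega)
    have h' : (R : ℝ) ≤ ((q : ℝ) ^ k - 1) ^ B * q ^ (n - B * k) := by
      have : ((q ^ k - 1 : ℕ) : ℝ) = (q : ℝ) ^ k - 1 := by
        rw [Nat.cast_sub hq1]; simp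
      rw [← this]
      exact_mod_cast h
    have e1 : ((q : ℝ) ^ k - 1) ^ B * q ^ (n - B * k) = (1 - ((q : ℝ) ^ k)⁻¹) ^ B * q ^ n := by
      have : (q : ℝ) ^ n = (q ^ k) ^ B * q ^ (n - B * k) := by
        rw [← pow_mul, ← pow_add]; congr 1; rw [mul_comm k B]; omega
      rw [this, ← mul_assoc, ← mul_pow]
      congr 2
      field_simp
    rw [e1] at h'
    have hinv : ((q : ℝ) ^ k)⁻¹ ≤ 1 := inv_le_one_of_one_le₀ (by exact_mod_cast hq1)
    have hb := bern ((q : ℝ) ^ k)⁻¹ (by positivity) hinv B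
    have hqs : (q : ℝ) ^ k ≤ (s : ℝ) ^ 7 := by
      have := Nat.pow_log_le_self q (x := s ^ 7) (by positivity)
      exact_mod_cast this
    have hBn : (s : ℝ) ^ 8 ≤ ((B : ℝ) + 1) * k := by
      have := Nat.lt_div_mul_add (a := n) (b := k) (by omega)
      rw [← hB] at this
      have h3 : s ^ 8 ≤ (B + 1) * k := by rw [Nat.add_mul, one_mul]; omega
      exact_mod_cast h3
    have hk0 : (0 : ℝ) < k := by exact_mod_cast hlog1
    have hd : (s : ℝ) / k ≤ 1 + B * ((q : ℝ) ^ k)⁻¹ := by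
      calc (s : ℝ) / k ≤ ((B : ℝ) + 1) * ((s : ℝ) ^ 7)⁻¹ := by
            rw [div_le_iff₀ hk0, ← div_eq_mul_inv, div_mul_eq_mul_div, le_div_iff₀ (by positivity)]
            calc (s : ℝ) * s ^ 7 = s ^ 8 := by ring
              _ ≤ _ := hBn
        _ ≤ ((B : ℝ) + 1) * ((q : ℝ) ^ k)⁻¹ := by gcongr
        _ = B * ((q : ℝ) ^ k)⁻¹ + ((q : ℝ) ^ k)⁻¹ := by ring
        _ ≤ _ := by linarith
    have hpow : 0 ≤ (1 - ((q : ℝ) ^ k)⁻¹) ^ B := pow_nonneg (by linarith) _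
    have hfin : (1 - ((q : ℝ) ^ k)⁻¹) ^ B ≤ k / s := by
      rw [le_div_iff₀ hs0]
      have := (mul_le_mul_of_nonneg_left hd hpow).trans hb
      rw [mul_div_assoc', div_le_one hk0] at this
      exact this
    refine h'.trans (mul_le_mul_of_nonneg_right ?_ hQ.le)
    have hl : (k : ℝ) / s ≤ 7 / Real.log 2 * (Real.log s / s) := by
      rw [← mul_div_assoc]
      gcongr
      exact log_bound hq (by omega)
    unfold err; linarith

lemma params (q : ℕ) (hq : 2 ≤ q) : ∃ (e : ℕ → ℝ) (m L k : ℕ → ℕ),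
    Tendsto e atTop (𝓝 0) ∧ Tendsto (fun n : ℕ => (n : ℝ) / m n) atTop atTop ∧
    ∀ᶠ n : ℕ in atTop, ∀ [NeZero n], Bds q n (L n) (m n) (k n) (e n) := by
  choose s h1 h2 using exists_root
  have hs : Tendsto s atTop atTop := by
    rw [tendsto_atTop]
    intro b
    filter_upwards [eventually_ge_atTop (b ^ 8)] with n hn
    have : b ^ 8 < (s n + 1) ^ 8 := lt_of_le_of_lt hn (h2 n)
    have := lt_of_pow_lt_pow_left₀ 8 (by positivity) this
    omega
  refine ⟨fun n => err q (s n), fun n => s n ^ 4, s, fun n => Nat.log q (s n ^ 7) - 1,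
    (err_lim q).comp hs, ?_, ?_⟩
  · have h3 : Tendsto (fun n => ((s n : ℕ) : ℝ) ^ 4) atTop atTop :=
      (tendsto_pow_atTop (by norm_num)).comp (tendsto_natCast_atTop_atTop.comp hs)
    refine tendsto_atTop_mono' _ ?_ h3
    filter_upwards [hs.eventually_ge_atTop 1] with n hn
    have : (1 : ℝ) ≤ s n := by exact_mod_cast hn
    push_cast
    rw [le_div_iff₀ (by positivity)]
    have := h1 n
    calc ((s n : ℕ) : ℝ) ^ 4 * (s n : ℝ) ^ 4 = (s n : ℝ) ^ 8 := by ring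
      _ ≤ (n : ℝ) := by exact_mod_cast this
  · have hl : ∀ᶠ t : ℕ in atTop, Nat.log q (t ^ 7) ≤ t := by
      filter_upwards [lim4.eventually_le_const (zero_lt_one), eventually_ge_atTop 1] with t ht ht1
      have h3 := log_bound (s := t) hq ht1
      have h4 : (0 : ℝ) < t := by exact_mod_cast ht1
      rw [← mul_div_assoc, div_le_one h4] at ht
      exact_mod_cast h3.trans ht
    filter_upwards [hs.eventually hl, hs.eventually_ge_atTop (q + 2)] with n a b
    intro _
    refine bds hq (h1 n) (h2 n) (by omega) a ?_
    have : q ≤ s n ^ 7 := (by omega : q ≤ s n).trans (Nat.le_self_pow (by norm_num) _)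
    exact Nat.log_pos (by omega) this

end

end LynAux

namespace LynAux

open Filter Topology

lemma ratio_lim {y a b : ℕ → ℝ} {x : ℝ} (hy : Tendsto y atTop atTop)
    (ha : ∀ᶠ n in atTop, |a n - x * y n| ≤ 4) (hb : ∀ᶠ n in atTop, |b n - y n| ≤ 4) :
    Tendsto (fun n => a n / b n) atTop (𝓝 x) := by
  have aux : ∀ (c : ℕ → ℝ) (z : ℝ), (∀ᶠ n in atTop, |c n - z * y n| ≤ 4) →
      Tendsto (fun n => c n / y n) atTop (𝓝 z) := by
    intro c z hc
    rw [tendsto_iff_norm_sub_tendsto_zero]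
    have h0 : Tendsto (fun n => 4 / y n) atTop (𝓝 0) := hy.const_div_atTop 4
    refine tendsto_of_tendsto_of_tendsto_of_le_of_le' tendsto_const_nhds h0 ?_ ?_
    · exact Eventually.of_forall fun n => norm_nonneg _
    · filter_upwards [hc, hy.eventually_gt_atTop 0] with n h1 h2
      rw [Real.norm_eq_abs, show c n / y n - z = (c n - z * y n) / y n by field_simp, abs_div,
        abs_of_pos h2]
      gcongr
  have h1 := aux a x ha
  have h2 := aux b 1 (by simpa using hb)
  have h3 := h1.div h2 one_ne_zero
  rw [div_one] at h3
  refine h3.congr' ?_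
  filter_upwards [hy.eventually_gt_atTop 0] with n h
  simp only [Pi.div_apply]
  rw [div_div_div_cancel_right₀ h.ne']

lemma lyn_card {q n : ℕ} [NeZero n] :
    (lyndonWords q n).card = cnt (fun w : Fin n → Fin q => LynF w) := by
  unfold lyndonWords
  rw [cnt_eq]
  exact cnt_congr fun w => lyndon_iff w

lemma num_card {q n : ℕ} [NeZero n] (x : ℝ) (hx : 0 ≤ x) :
    ((lyndonWords q n).filter fun w => (srfLen (List.ofFn w) : ℝ) ≤ x * n).card =
      cnt (fun w : Fin n → Fin q => LynF w ∧ srfLen (List.ofFn w) ≤ ⌊x * n⌋₊) := by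
  unfold lyndonWords
  rw [Finset.filter_filter, cnt_eq]
  refine cnt_congr fun w => ?_
  rw [lyndon_iff w, Nat.le_floor_iff (by positivity)]

lemma main (q : ℕ) (hq : 2 ≤ q) (x : ℝ) (hx0 : 0 ≤ x) (hx1 : x < 1) :
    Tendsto (fun n : ℕ =>
        ((((lyndonWords q n).filter fun w =>
            (srfLen (List.ofFn w) : ℝ) ≤ x * n).card : ℝ)
          / ((lyndonWords q n).card : ℝ)))
      atTop (𝓝 (((q : ℝ) - 1) * x / q)) := by
  obtain ⟨e, m, L, k, he, hy, hB⟩ := params q hq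
  have hqr : (2 : ℝ) ≤ q := by exact_mod_cast hq
  have hq0 : (0 : ℝ) < q := by linarith
  set y : ℕ → ℝ := fun n => (n : ℝ) / m n with hyd
  set num : ℕ → ℝ := fun n => ((((lyndonWords q n).filter fun w =>
            (srfLen (List.ofFn w) : ℝ) ≤ x * n).card : ℝ)) with hnum
  set ell : ℕ → ℝ := fun n => ((lyndonWords q n).card : ℝ) with hell
  set v : ℕ → ℝ := fun n => n * ell n / q ^ n with hv
  set W : ℕ → ℝ := fun n => n * num n / q ^ n with hW
  -- the number of Lyndon words
  have hvlim : Tendsto v atTop (𝓝 1) := by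
    have h1 : Tendsto (fun n => 1 - e n) atTop (𝓝 1) := by
      simpa using tendsto_const_nhds.sub he
    refine tendsto_of_tendsto_of_tendsto_of_le_of_le' h1 tendsto_const_nhds ?_ ?_
    · filter_upwards [hB, eventually_ge_atTop 2] with n hBn hn
      haveI : NeZero n := ⟨by omega⟩
      have hQ : (0 : ℝ) < (q : ℝ) ^ n := by positivity
      have b := (lyn_bounds (n := n) (q := q) (L n) hn).2
      rw [← lyn_card] at b
      have b' : (q : ℝ) ^ n ≤ n * ell n + cnt (fun w : Fin n → Fin q => ¬ Gd (L n) w) := by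
        simp only [hell]
        exact_mod_cast b
      have c := hBn.hG
      simp only [hv]
      rw [le_div_iff₀ hQ]
      linarith
    · filter_upwards [hB, eventually_ge_atTop 2] with n hBn hn
      haveI : NeZero n := ⟨by omega⟩
      have hQ : (0 : ℝ) < (q : ℝ) ^ n := by positivity
      have b := (lyn_bounds (n := n) (q := q) (L n) hn).1
      rw [← lyn_card] at b
      have b' : n * ell n ≤ (q : ℝ) ^ n := by
        simp only [hell]
        exact_mod_cast b
      simp only [hv]
      rw [div_le_one hQ]
      exact b'
  set u : ℕ → ℝ := fun N => (N + 1 : ℕ) * ell N / q ^ (N + 1) with hu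
  have hulim : Tendsto u atTop (𝓝 (1 / q)) := by
    have h1 : Tendsto (fun N : ℕ => ((N : ℝ) + 1) / N) atTop (𝓝 1) := by
      have h2 : Tendsto (fun N : ℕ => 1 + 1 / (N : ℝ)) atTop (𝓝 (1 + 0)) :=
        tendsto_const_nhds.add tendsto_one_div_atTop_nhds_zero_nat
      rw [add_zero] at h2
      refine h2.congr' ?_
      filter_upwards [eventually_ge_atTop 1] with N hN
      have : (0 : ℝ) < N := by exact_mod_cast hN
      field_simp
    have h3 := (h1.mul hvlim).div_const (q : ℝ)
    rw [one_mul] at h3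
    refine h3.congr' ?_
    filter_upwards [eventually_ge_atTop 1] with N hN
    have : (0 : ℝ) < N := by exact_mod_cast hN
    simp only [hu, hv]
    push_cast
    rw [pow_succ]
    field_simp
  -- parameters
  set M : ℕ → ℕ := fun n => n / m n with hM
  set K : ℕ → ℕ := fun n => ⌊x * n⌋₊ with hK
  have hmpos : ∀ᶠ n in atTop, 0 < m n := by
    filter_upwards [hB, eventually_ge_atTop 2] with n hBn hn
    haveI : NeZero n := ⟨by omega⟩
    exact hBn.hm
  have hMb : ∀ᶠ n in atTop, y n - 1 ≤ M n ∧ (M n : ℝ) ≤ y n := by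
    filter_upwards [hmpos] with n hm
    have hm' : (0 : ℝ) < m n := by exact_mod_cast hm
    constructor
    · have := Nat.lt_div_mul_add (a := n) hm
      have h2 : (n : ℝ) ≤ M n * m n + m n := by exact_mod_cast this.le
      simp only [hyd]
      rw [sub_le_iff_le_add, div_le_iff₀ hm']
      linarith
    · exact Nat.cast_div_le
  have hKb : ∀ᶠ n in atTop, x * y n - 2 ≤ (K n / m n : ℕ) ∧ ((K n / m n : ℕ) : ℝ) ≤ x * y n := by
    filter_upwards [hmpos] with n hm
    have hm' : (1 : ℝ) ≤ m n := by exact_mod_cast hm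
    have hxn : 0 ≤ x * n := by positivity
    have k1 : x * n < K n + 1 := Nat.lt_floor_add_one _
    have k2 : (K n : ℝ) ≤ x * n := Nat.floor_le hxn
    constructor
    · have := Nat.lt_div_mul_add (a := K n) hm
      have h2 : (K n : ℝ) ≤ (K n / m n : ℕ) * m n + m n := by exact_mod_cast this.le
      simp only [hyd]
      rw [sub_le_iff_le_add, ← mul_div_assoc, div_le_iff₀ (by linarith)]
      linarith
    · refine Nat.cast_div_le.trans ?_
      simp only [hyd]
      rw [← mul_div_assoc]
      gcongr
  have hT1 : Tendsto (fun n => ((K n / m n + 1 : ℕ) : ℝ) / ((M n : ℝ) - 1)) atTop (𝓝 x) := by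
    refine ratio_lim hy ?_ ?_
    · filter_upwards [hKb] with n h
      push_cast
      rw [abs_le]
      constructor <;> linarith [h.1, h.2]
    · filter_upwards [hMb] with n h
      rw [abs_le]
      constructor <;> linarith [h.1, h.2]
  have hT2 : Tendsto (fun n => ((K n / m n - 2 : ℕ) : ℝ) / ((M n : ℝ) - 1)) atTop (𝓝 x) := by
    refine ratio_lim hy ?_ ?_
    · filter_upwards [hKb] with n h
      have h1 : ((K n / m n : ℕ) : ℝ) ≤ ((K n / m n - 2 : ℕ) : ℝ) + 2 := by
        have : K n / m n ≤ K n / m n - 2 + 2 := by omega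
        exact_mod_cast this
      have h2 : ((K n / m n - 2 : ℕ) : ℝ) ≤ (K n / m n : ℕ) := by
        have : K n / m n - 2 ≤ K n / m n := Nat.sub_le _ _
        exact_mod_cast this
      rw [abs_le]
      constructor <;> linarith [h.1, h.2]
    · filter_upwards [hMb] with n h
      rw [abs_le]
      constructor <;> linarith [h.1, h.2]
  have hKM : ∀ᶠ n in atTop, K n / m n + 1 < M n := by
    have h1 : Tendsto (fun n => (1 - x) * y n) atTop atTop :=
      hy.const_mul_atTop (by linarith)
    filter_upwards [hKb, hMb, h1.eventually_gt_atTop 2] with n a b c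
    have : ((K n / m n : ℕ) : ℝ) + 1 < M n := by linarith [a.2, b.1]
    exact_mod_cast this
  have hM2 : ∀ᶠ n in atTop, 2 ≤ M n := by
    filter_upwards [hMb, hy.eventually_ge_atTop 3] with n b c
    have : (2 : ℝ) ≤ M n := by linarith [b.1]
    exact_mod_cast this
  have hKn : ∀ᶠ n in atTop, K n + 1 < n := by
    have h1 : Tendsto (fun n : ℕ => (1 - x) * (n : ℝ)) atTop atTop :=
      tendsto_natCast_atTop_atTop.const_mul_atTop (by linarith)
    filter_upwards [h1.eventually_gt_atTop 1] with n c
    have k2 : (K n : ℝ) ≤ x * n := Nat.floor_le (by positivity)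
    have : (K n : ℝ) + 1 < n := by linarith
    exact_mod_cast this
  -- the two bounds for W
  have hcore : ∀ᶠ N in atTop,
      W (N + 1) ≤ (1 - u N + e (N + 1)) *
        (((K (N + 1) / m (N + 1) + 1 : ℕ) : ℝ) / ((M (N + 1) : ℝ) - 1)) + 5 * e (N + 1) ∧
      (1 - u N - 4 * e (N + 1)) *
        (((K (N + 1) / m (N + 1) - 2 : ℕ) : ℝ) / ((M (N + 1) : ℝ) - 1)) - e (N + 1) ≤
      W (N + 1) := by
    have sh := tendsto_add_atTop_nat 1
    filter_upwards [sh.eventually hB, sh.eventually hKM, sh.eventually hM2, sh.eventually hKn,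
      eventually_ge_atTop 2] with N hBn hKMn hM2n hKnn hN
    haveI : NeZero N := ⟨by omega⟩
    have b := @hBn _
    have hmod := Nat.lt_div_mul_add (a := N + 1) b.hm
    have c := core (N := N) (q := q) (L (N + 1)) (m (N + 1)) (M (N + 1)) (k (N + 1)) (K (N + 1))
      (e (N + 1)) (by omega) hN b.hL b.hm (Nat.div_mul_le_self _ _) hmod hM2n (by omega) hKMn
      b.hG b.hh b.hC b.hR
    rw [← lyn_card, ← num_card x hx0] at c
    have hQ : (0 : ℝ) < (q : ℝ) ^ (N + 1) := by positivity
    have hMr : (0 : ℝ) < (M (N + 1) : ℝ) - 1 := by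
      have : (2 : ℝ) ≤ M (N + 1) := by exact_mod_cast hM2n
      linarith
    have e1 : (((N + 1) * ((lyndonWords q (N + 1)).filter fun w =>
        (srfLen (List.ofFn w) : ℝ) ≤ x * (N + 1 : ℕ)).card : ℕ) : ℝ) =
        W (N + 1) * q ^ (N + 1) := by
      simp only [hW, hnum]
      rw [div_mul_cancel₀ _ hQ.ne']
      push_cast
      rfl
    have e2 : (((N + 1) * (lyndonWords q N).card : ℕ) : ℝ) = u N * q ^ (N + 1) := by
      simp only [hu, hell]
      rw [div_mul_cancel₀ _ hQ.ne']
      push_cast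
      rfl
    rw [e1, e2] at c
    obtain ⟨c1, c2⟩ := c
    set Q := (q : ℝ) ^ (N + 1)
    set R := (M (N + 1) : ℝ) - 1
    constructor
    · rw [mul_div_assoc', ← sub_le_iff_le_add, le_div_iff₀ hMr]
      refine le_of_mul_le_mul_right ?_ hQ
      linarith
    · rw [mul_div_assoc', sub_le_iff_le_add, div_le_iff₀ hMr]
      refine le_of_mul_le_mul_right ?_ hQ
      linarith
  have sh := tendsto_add_atTop_nat 1
  have he' := he.comp sh
  have hWlim : Tendsto (fun N => W (N + 1)) atTop (𝓝 (((q : ℝ) - 1) * x / q)) := by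
    have l1 := ((((tendsto_const_nhds (x := (1 : ℝ))).sub hulim).add he').mul
      (hT1.comp sh)).add (he'.const_mul 5)
    have l2 := ((((tendsto_const_nhds (x := (1 : ℝ))).sub hulim).sub (he'.const_mul 4)).mul
      (hT2.comp sh)).sub he'
    have g1 : (1 - 1 / (q : ℝ) + 0) * x + 5 * 0 = ((q : ℝ) - 1) * x / q := by
      field_simp; ring
    have g2 : (1 - 1 / (q : ℝ) - 4 * 0) * x - 0 = ((q : ℝ) - 1) * x / q := by
      field_simp; ring
    rw [g1] at l1
    rw [g2] at l2
    refine tendsto_of_tendsto_of_tendsto_of_le_of_le' l2 l1 ?_ ?_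
    · filter_upwards [hcore] with N h using h.2
    · filter_upwards [hcore] with N h using h.1
  rw [← tendsto_add_atTop_iff_nat 1]
  have hfin := hWlim.div (hvlim.comp sh) one_ne_zero
  rw [div_one] at hfin
  refine hfin.congr fun N => ?_
  simp only [Pi.div_apply, Function.comp, hW, hv]
  have hQ : (0 : ℝ) < (q : ℝ) ^ (N + 1) := by positivity
  have hN : (0 : ℝ) < ((N + 1 : ℕ) : ℝ) := by positivity
  rw [div_div_div_cancel_right₀ hQ.ne', mul_div_mul_left _ _ hN.ne']

end LynAux

theorem stmt_0 (q : ℕ) (hq : 2 ≤ q) (x : ℝ) (hx0 : 0 ≤ x) (hx1 : x < 1) :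
    Filter.Tendsto (fun n : ℕ =>
        ((((lyndonWords q n).filter fun w =>
            (srfLen (List.ofFn w) : ℝ) ≤ x * n).card : ℝ)
          / ((lyndonWords q n).card : ℝ)))
      Filter.atTop (nhds (((q : ℝ) - 1) * x / q)) := by
  exact LynAux.main q hq x hx0 hx1
end

section
/- Let q ≥ 2 and for each n ≥ 2 let R_n denote the length of the standard right factor of a uniformly random Lyndon word of length n over a totally ordered alphabet with q letters. Then the probability that R_n = n−1 converges to 1/q as n → ∞. -/
open scoped Classical

section Aux

variable {α : Type*} [LinearOrder α]

lemma lyn_lt_append {a b : List α} (h : List.Lex (· < ·) a b) (hl : b.length ≤ a.length)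
    (c d : List α) : List.Lex (· < ·) (a ++ c) (b ++ d) := by
  induction h with
  | nil => simp at hl
  | rel h => exact List.Lex.rel h
  | cons h ih => exact List.Lex.cons (ih (by simpa using hl))

lemma lyn_append_cancel (a : List α) {c d : List α} (h : a ++ c < a ++ d) : c < d := by
  induction a with
  | nil => simpa using h
  | cons x a ih =>
    apply ih
    have h' : List.Lex (· < ·) (x :: (a ++ c)) (x :: (a ++ d)) := h
    cases h' with
    | rel h => exact absurd h (lt_irrefl _)
    | cons h => exact h

lemma lyn_lt_rotate {w : List α} (hw : IsLyndon w) {i : ℕ} (h0 : 0 < i) (hi : i < w.length) :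
    w < w.rotate i := by
  have := lyn_lt_append (hw i h0 hi) (by simp) [] (w.take i)
  rw [List.append_nil] at this
  rw [List.rotate_eq_drop_append_take hi.le]
  exact this

lemma lyn_of_lt_rotate {w : List α} (hw : ∀ i, 0 < i → i < w.length → w < w.rotate i) :
    IsLyndon w := by
  intro i h0 hi
  set n := w.length with hn
  have h1 := hw i h0 hi
  have h2 := hw (n - i) (by omega) (by omega)
  rw [List.rotate_eq_drop_append_take (by omega)] at h1 h2
  have e1 : w = w.take (n - i) ++ w.drop (n - i) := (List.take_append_drop _ _).symm
  have e2 : w = w.take i ++ w.drop i := (List.take_append_drop _ _).symm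
  rcases lt_trichotomy (w.drop i) (w.take (n - i)) with h | h | h
  · have : w.drop i ++ w.take i < w.take (n - i) ++ w.drop (n - i) :=
      lyn_lt_append h (by simp; omega) _ _
    rw [← e1] at this
    exact absurd h1 (lt_asymm this)
  · exfalso
    rw [h] at h1
    have h1' : w.take (n - i) ++ w.drop (n - i) < w.take (n - i) ++ w.take i := by
      rw [← e1]; exact h1
    have h3 := lyn_append_cancel _ h1'
    have h4 : w.drop (n - i) ++ w.take (n - i) < w.take i ++ w.drop i :=
      lyn_lt_append h3 (by simp; omega) _ _
    rw [← e2] at h4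
    exact absurd h2 (lt_asymm h4)
  · have : w.take (n - i) ++ w.drop (n - i) < w.drop i ++ [] :=
      lyn_lt_append h (by simp; omega) _ _
    rw [← e1, List.append_nil] at this
    exact this

lemma lyn_srf {w : List α} (hn : 2 ≤ w.length) :
    srfLen w = w.length - 1 ↔ IsLyndon (w.drop 1) := by
  unfold srfLen
  set S := {i | 0 < i ∧ i < w.length ∧
    ∀ j, 0 < j → j < w.length → ¬ List.Lex (· < ·) (w.drop j) (w.drop i)} with hS
  have key : 1 ∈ S ↔ IsLyndon (w.drop 1) := by
    constructor
    · rintro ⟨-, -, h⟩ i h0 hi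
      rw [List.length_drop] at hi
      have h3 := h (1 + i) (by omega) (by omega)
      rw [List.drop_drop]
      have h4 : w.drop 1 ≤ w.drop (1 + i) := not_lt.1 h3
      refine lt_of_le_of_ne h4 fun h => ?_
      have := congrArg List.length h
      simp at this
      omega
    · intro h
      refine ⟨by omega, by omega, fun j h0 hj hlt => ?_⟩
      rcases Nat.lt_or_ge 1 j with h1 | h1
      · have h2 := h (j - 1) (by omega) (by simp; omega)
        rw [List.drop_drop, show 1 + (j - 1) = j by omega] at h2
        exact lt_asymm (show w.drop j < w.drop 1 from hlt) h2
      · have : j = 1 := by omega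
        subst this
        exact lt_irrefl (w.drop 1) hlt
  rw [← key]
  constructor
  · intro h
    have h1 : sInf S = 1 := by omega
    have hne : S.Nonempty := by
      by_contra hne
      rw [Set.not_nonempty_iff_eq_empty] at hne
      rw [hne] at h1
      simp at h1
    have := Nat.sInf_mem hne
    rwa [h1] at this
  · intro h
    have h1 : sInf S ≤ 1 := Nat.sInf_le h
    have h2 : 0 < sInf S := (Nat.sInf_mem ⟨1, h⟩).1
    rw [show sInf S = 1 by omega]

lemma lyn_cons {z : α} (hz : ∀ x, z ≤ x) {v : List α} (hv : 2 ≤ v.length) (h : IsLyndon v) :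
    IsLyndon (z :: v) := by
  have h0 : z :: v < v := by
    match v, hv, h with
    | b :: v', hv, h =>
      rcases (hz b).lt_or_eq with hb | hb
      · exact List.Lex.rel hb
      · subst hb
        have := h 1 (by omega) (by omega)
        exact List.Lex.cons this
  intro i hi hl
  obtain ⟨i, rfl⟩ : ∃ k, i = k + 1 := ⟨i - 1, by omega⟩
  rw [List.drop_succ_cons]
  rcases Nat.eq_zero_or_pos i with h1 | h1
  · subst h1; exact h0
  · exact lt_trans h0 (h i h1 (by simpa using hl))

lemma lyn_head_le {a : α} {v : List α} (h : IsLyndon (a :: v)) : ∀ x ∈ a :: v, a ≤ x := by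
  intro x hx
  obtain ⟨i, hi, rfl⟩ := List.getElem_of_mem hx
  rcases Nat.eq_zero_or_pos i with h1 | h1
  · subst h1; simp
  · have := h i h1 hi
    rw [List.drop_eq_getElem_cons hi] at this
    generalize (a :: v)[i] = y at this
    cases this with
    | rel h => exact h.le
    | cons h => exact le_rfl

lemma lyn_period {u v : List α} {k n : ℕ} (hk0 : 0 < k) (hkn : k ≤ n)
    (hu : u.length = n) (hv : v.length = n)
    (h1 : u.rotate k = u) (h2 : v.rotate k = v) (h : u.take k = v.take k) : u = v := by
  have per : ∀ (u : List α), u.length = n → u.rotate k = u →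
      ∀ i, k ≤ i → u[i]? = if i < n then u[i - k]? else none := by
    intro u hu h i hi
    split_ifs with hin
    · have e : (u.rotate k)[i - k]? = u[i - k]? := by rw [h]
      rw [← e, List.rotate_eq_drop_append_take (by omega), List.getElem?_append_left (by simp; omega),
        List.getElem?_drop]
      congr 1; omega
    · simp; omega
  apply List.ext_getElem?
  intro i
  induction i using Nat.strong_induction_on with
  | _ i ih =>
    rcases Nat.lt_or_ge i k with hi | hi
    · rw [← List.getElem?_take_of_lt hi, h, List.getElem?_take_of_lt hi]
    · rw [per u hu h1 i hi, per v hv h2 i hi, ih (i - k) (by omega)]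

end Aux

/-- All words of length n, as lists. -/
noncomputable def lynW (q n : ℕ) : Finset (List (Fin q)) :=
  (Finset.univ : Finset (Fin n → Fin q)).image List.ofFn

lemma lynW_mem {q n : ℕ} {w : List (Fin q)} : w ∈ lynW q n ↔ w.length = n := by
  unfold lynW
  simp only [Finset.mem_image, Finset.mem_univ, true_and]
  constructor
  · rintro ⟨f, rfl⟩; simp
  · rintro rfl; exact ⟨w.get, List.ofFn_get w⟩

lemma lynW_card (q n : ℕ) : (lynW q n).card = q ^ n := by
  unfold lynW
  rw [Finset.card_image_of_injective _ List.ofFn_injective]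
  simp

/-- Lyndon words of length n, as lists. -/
noncomputable def lynL (q n : ℕ) : Finset (List (Fin q)) := (lynW q n).filter IsLyndon

lemma lynL_mem {q n : ℕ} {w : List (Fin q)} : w ∈ lynL q n ↔ w.length = n ∧ IsLyndon w := by
  simp [lynL, lynW_mem]

lemma lynL_card (q n : ℕ) : (lyndonWords q n).card = (lynL q n).card := by
  rw [← Finset.card_image_of_injective _ (List.ofFn_injective (n := n))]
  congr 1
  ext w
  rw [lynL_mem]
  simp only [lyndonWords, Finset.mem_image, Finset.mem_filter, Finset.mem_univ, true_and]
  constructor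
  · rintro ⟨f, hf, rfl⟩; exact ⟨by simp, hf⟩
  · rintro ⟨rfl, h⟩; exact ⟨w.get, by rwa [List.ofFn_get], List.ofFn_get w⟩

lemma lynC_card (q n : ℕ) (hn : 2 ≤ n) :
    ((lyndonWords q n).filter fun w => srfLen (List.ofFn w) = n - 1).card
      = ((lynL q n).filter fun w => IsLyndon (w.drop 1)).card := by
  rw [← Finset.card_image_of_injective _ (List.ofFn_injective (n := n))]
  congr 1
  ext w
  rw [Finset.mem_filter, lynL_mem]
  simp only [lyndonWords, Finset.mem_image, Finset.mem_filter, Finset.mem_univ, true_and]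
  constructor
  · rintro ⟨f, ⟨hf, hs⟩, rfl⟩
    refine ⟨⟨by simp, hf⟩, ?_⟩
    rw [← lyn_srf (by simpa using hn)]
    simpa using hs
  · rintro ⟨⟨rfl, h⟩, h'⟩
    refine ⟨w.get, ⟨by rwa [List.ofFn_get], ?_⟩, List.ofFn_get w⟩
    rw [List.ofFn_get]
    exact (lyn_srf hn).2 h'

lemma lyn_upper (q n : ℕ) : n * (lynL q n).card ≤ q ^ n := by
  rw [← lynW_card, mul_comm, ← Finset.card_range n, Finset.card_range n]
  conv_lhs => rw [← Finset.card_range n, Finset.card_range n]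
  have : (lynL q n).card * n = (lynL q n ×ˢ Finset.range n).card := by simp
  rw [this]
  apply Finset.card_le_card_of_injOn (fun p => p.1.rotate p.2)
  · rintro ⟨w, k⟩ h
    simp only [Finset.coe_product, Set.mem_prod, Finset.mem_coe, lynL_mem] at h
    simp [lynW_mem, h.1.1]
  · -- one-sided version
    have key : ∀ (w v : List (Fin q)) (j k : ℕ), w.length = n → IsLyndon w → v.length = n →
        IsLyndon v → j ≤ k → k < n → w.rotate j = v.rotate k → w = v ∧ j = k := by
      intro w v j k hw hwL hv hvL hjk hk h
      have e : v.rotate (k - j) = w := by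
        apply List.rotate_injective j
        simp only [List.rotate_rotate]
        rw [h]; congr 1; omega
      have e' : w.rotate (n - (k - j)) = v := by
        rw [← e, List.rotate_rotate, show k - j + (n - (k - j)) = v.length by omega,
          List.rotate_length]
      rcases Nat.eq_zero_or_pos (k - j) with h0 | h0
      · refine ⟨?_, by omega⟩
        rw [h0, List.rotate_zero] at e; exact e.symm
      · have l1 := lyn_lt_rotate hvL h0 (by omega)
        have l2 := lyn_lt_rotate hwL (i := n - (k - j)) (by omega) (by omega)
        rw [e] at l1
        rw [e'] at l2
        exact absurd l1 (lt_asymm l2)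
    rintro ⟨w, j⟩ h1 ⟨v, k⟩ h2 h
    simp only [Finset.coe_product, Set.mem_prod, Finset.mem_coe, lynL_mem, Finset.mem_range] at h1 h2
    simp only at h
    rcases le_total j k with hjk | hjk
    · obtain ⟨a, b⟩ := key w v j k h1.1.1 h1.1.2 h2.1.1 h2.1.2 hjk h2.2 h
      rw [a, b]
    · obtain ⟨a, b⟩ := key v w k j h2.1.1 h2.1.2 h1.1.1 h1.1.2 hjk h1.2 h.symm
      rw [a, b]

lemma lyn_per_card (q n k : ℕ) (h0 : 0 < k) (hk : k ≤ n) :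
    ((lynW q n).filter fun u => u.rotate k = u).card ≤ q ^ k := by
  rw [← lynW_card q k]
  apply Finset.card_le_card_of_injOn (fun u => u.take k)
  · intro u hu
    simp only [Finset.coe_filter, Set.mem_ofPred_eq, lynW_mem] at hu
    simp [lynW_mem, hu.1, hk]
  · intro u hu v hv h
    simp only [Finset.coe_filter, Set.mem_ofPred_eq, lynW_mem] at hu hv
    exact lyn_period h0 hk hu.1 hv.1 hu.2 hv.2 h

lemma lyn_lower (q n : ℕ) (hq : 2 ≤ q) (hn : 1 ≤ n) :
    q ^ n ≤ n * (lynL q n).card + n * q ^ (n / 2) := by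
  have hsub : lynW q n ⊆ (lynL q n ×ˢ Finset.range n).image (fun p => p.1.rotate p.2) ∪
      (Finset.Icc 1 (n / 2)).biUnion (fun k => (lynW q n).filter fun u => u.rotate k = u) := by
    intro u hu
    rw [lynW_mem] at hu
    rw [Finset.mem_union]
    by_cases hp : ∃ k, 0 < k ∧ k < n ∧ u.rotate k = u
    · right
      obtain ⟨k, h0, hk, h⟩ := hp
      simp only [Finset.mem_biUnion, Finset.mem_Icc, Finset.mem_filter, lynW_mem]
      by_cases hk2 : k ≤ n / 2
      · exact ⟨k, ⟨h0, hk2⟩, hu, h⟩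
      · refine ⟨n - k, ⟨by omega, by omega⟩, hu, ?_⟩
        conv_lhs => rw [← h, List.rotate_rotate, show k + (n - k) = u.length by omega,
          List.rotate_length]
    · left
      push Not at hp
      obtain ⟨m, hm, hmin⟩ := Finset.exists_min_image (Finset.range n) (fun i => u.rotate i)
        ⟨0, by simp; omega⟩
      rw [Finset.mem_range] at hm
      have hmin' : ∀ i, u.rotate m ≤ u.rotate i := by
        intro i
        rw [← List.rotate_mod u i, hu]
        exact hmin _ (Finset.mem_range.2 (Nat.mod_lt _ (by omega)))
      rw [Finset.mem_image]
      refine ⟨(u.rotate m, (n - m) % n), ?_, ?_⟩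
      · rw [Finset.mem_product, lynL_mem, Finset.mem_range]
        refine ⟨⟨by simpa using hu, ?_⟩, Nat.mod_lt _ (by omega)⟩
        apply lyn_of_lt_rotate
        intro i h0 hi
        rw [List.length_rotate, hu] at hi
        refine lt_of_le_of_ne ?_ ?_
        · rw [List.rotate_rotate]; exact hmin' _
        · intro h
          apply hp i h0 hi
          apply List.rotate_injective m
          simp only [List.rotate_rotate] at h ⊢
          rw [h, add_comm]
      · simp only
        have : (u.rotate m).rotate ((n - m) % n) = (u.rotate m).rotate (n - m) := by
          rw [← List.rotate_mod (u.rotate m) (n - m), List.length_rotate, hu]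
        rw [this, List.rotate_rotate, show m + (n - m) = u.length by omega, List.rotate_length]
  have h1 := (Finset.card_le_card hsub).trans (Finset.card_union_le _ _)
  rw [lynW_card] at h1
  have h2 : ((lynL q n ×ˢ Finset.range n).image (fun p => p.1.rotate p.2)).card
      ≤ n * (lynL q n).card := by
    refine Finset.card_image_le.trans ?_
    simp [mul_comm]
  have h3 : ((Finset.Icc 1 (n / 2)).biUnion
      (fun k => (lynW q n).filter fun u => u.rotate k = u)).card ≤ n * q ^ (n / 2) := by
    refine (Finset.card_biUnion_le_card_mul _ _ (q ^ (n / 2)) ?_).trans ?_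
    · intro k hk
      rw [Finset.mem_Icc] at hk
      exact (lyn_per_card q n k (by omega) (by omega)).trans
        (Nat.pow_le_pow_right (by omega) hk.2)
    · apply Nat.mul_le_mul_right
      simp; omega
  omega

lemma lynC_lower (q n : ℕ) (hq : 2 ≤ q) (hn : 2 ≤ n) :
    (lynL q n).card ≤ ((lynL q (n + 1)).filter fun w => IsLyndon (w.drop 1)).card := by
  apply Finset.card_le_card_of_injOn (fun v => (⟨0, by omega⟩ : Fin q) :: v)
  · intro v hv
    rw [Finset.mem_coe, lynL_mem] at hv
    simp only [Finset.coe_filter, Set.mem_ofPred_eq, lynL_mem]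
    refine ⟨⟨by simp [hv.1], lyn_cons (fun x => ?_) (by omega) hv.2⟩, by simpa using hv.2⟩
    simp [Fin.le_def]
  · intro v _ v' _ h
    simpa using h

lemma lyn_nozero_card (q n : ℕ) (hq : 2 ≤ q) :
    ((lynW q n).filter fun w => ∀ x ∈ w, x ≠ (⟨0, by omega⟩ : Fin q)).card = (q - 1) ^ n := by
  have : ((lynW q n).filter fun w => ∀ x ∈ w, x ≠ (⟨0, by omega⟩ : Fin q)) =
      (Fintype.piFinset fun _ : Fin n => (Finset.univ.erase (⟨0, by omega⟩ : Fin q))).image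
        List.ofFn := by
    ext w
    simp only [Finset.mem_filter, lynW_mem, Finset.mem_image, Fintype.mem_piFinset,
      Finset.mem_erase, Finset.mem_univ, and_true]
    constructor
    · rintro ⟨rfl, h⟩
      exact ⟨w.get, fun i => h _ (List.get_mem w i), List.ofFn_get w⟩
    · rintro ⟨f, hf, rfl⟩
      refine ⟨by simp, fun x hx => ?_⟩
      rw [List.mem_ofFn] at hx
      obtain ⟨i, rfl⟩ := hx
      exact hf i
  rw [this, Finset.card_image_of_injective _ List.ofFn_injective]
  simp

lemma lynC_upper (q n : ℕ) (hq : 2 ≤ q) :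
    ((lynL q (n + 1)).filter fun w => IsLyndon (w.drop 1)).card
      ≤ (lynL q n).card + (q - 1) ^ (n + 1) := by
  rw [← lyn_nozero_card q (n + 1) hq]
  have hsub : ((lynL q (n + 1)).filter fun w => IsLyndon (w.drop 1)) ⊆
      (lynL q n).image (fun v => (⟨0, by omega⟩ : Fin q) :: v) ∪
      ((lynW q (n + 1)).filter fun w => ∀ x ∈ w, x ≠ (⟨0, by omega⟩ : Fin q)) := by
    intro w hw
    rw [Finset.mem_filter, lynL_mem] at hw
    obtain ⟨⟨hl, hL⟩, hd⟩ := hw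
    match w, hl, hL, hd with
    | a :: v, hl, hL, hd =>
      rw [Finset.mem_union]
      by_cases ha : a = (⟨0, by omega⟩ : Fin q)
      · left
        rw [Finset.mem_image]
        exact ⟨v, lynL_mem.2 ⟨by simpa using hl, by simpa using hd⟩, by rw [ha]⟩
      · right
        rw [Finset.mem_filter, lynW_mem]
        refine ⟨hl, fun x hx h => ha ?_⟩
        have := lyn_head_le hL x hx
        subst h
        apply Fin.ext
        simpa [Fin.le_def] using this
  refine (Finset.card_le_card hsub).trans ((Finset.card_union_le _ _).trans ?_)
  exact Nat.add_le_add_right Finset.card_image_le _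

lemma lyn_asymp (q : ℕ) (hq : 2 ≤ q) :
    Filter.Tendsto (fun n : ℕ => (n : ℝ) * ((lynL q n).card : ℝ) / (q : ℝ) ^ n)
      Filter.atTop (nhds 1) := by
  have hq0 : (0 : ℝ) < q := by positivity
  have hq1 : (1 : ℝ) < q := by exact_mod_cast (by omega : 1 < q)
  have hz : Filter.Tendsto (fun m : ℕ => (2 * (m : ℝ) + 1) / (q : ℝ) ^ m)
      Filter.atTop (nhds 0) := by
    have h1 := tendsto_pow_const_div_const_pow_of_one_lt 1 hq1
    have h0 := tendsto_pow_const_div_const_pow_of_one_lt 0 hq1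
    have := (h1.const_mul 2).add h0
    simp only [mul_zero, add_zero] at this
    refine this.congr fun m => ?_
    ring
  have hz2 := hz.comp (Nat.tendsto_div_const_atTop (n := 2) (by norm_num))
  have hlow : Filter.Tendsto (fun n : ℕ => 1 - (2 * ((n / 2 : ℕ) : ℝ) + 1) / (q : ℝ) ^ (n / 2))
      Filter.atTop (nhds 1) := by
    have := hz2.const_sub 1
    simpa using this
  refine tendsto_of_tendsto_of_tendsto_of_le_of_le' hlow tendsto_const_nhds ?_ ?_
  · filter_upwards [Filter.eventually_ge_atTop 1] with n hn
    have h : (q : ℝ) ^ n ≤ n * ((lynL q n).card : ℝ) + n * (q : ℝ) ^ (n / 2) := by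
      exact_mod_cast lyn_lower q n hq hn
    have hpow : (q : ℝ) ^ (n / 2) * (q : ℝ) ^ (n / 2) ≤ (q : ℝ) ^ n := by
      rw [← pow_add]
      exact pow_le_pow_right₀ hq1.le (by omega)
    have hn2 : (n : ℝ) ≤ 2 * ((n / 2 : ℕ) : ℝ) + 1 := by
      exact_mod_cast (by omega : n ≤ 2 * (n / 2) + 1)
    have hm : (0 : ℝ) < (q : ℝ) ^ (n / 2) := by positivity
    rw [le_div_iff₀ (by positivity), sub_mul, one_mul, sub_le_iff_le_add]
    refine h.trans (add_le_add_right ?_ _)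
    rw [div_mul_eq_mul_div, le_div_iff₀ hm, mul_assoc]
    gcongr
  · refine Filter.Eventually.of_forall fun n => ?_
    rw [div_le_one (by positivity)]
    exact_mod_cast lyn_upper q n

lemma lyn_ratio (q : ℕ) (hq : 2 ≤ q) :
    Filter.Tendsto (fun n : ℕ => ((lynL q n).card : ℝ) / ((lynL q (n + 1)).card : ℝ))
      Filter.atTop (nhds (1 / (q : ℝ))) := by
  have hq0 : (0 : ℝ) < q := by positivity
  have h := lyn_asymp q hq
  have h' := h.comp (Filter.tendsto_add_atTop_nat 1)
  have hn : Filter.Tendsto (fun n : ℕ => 1 + 1 / (n : ℝ)) Filter.atTop (nhds 1) := by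
    simpa using (tendsto_one_div_atTop_nhds_zero_nat (𝕜 := ℝ)).const_add 1
  have := ((h.div h' one_ne_zero).mul hn).mul_const (1 / (q : ℝ))
  simp only [div_one, one_mul] at this
  refine this.congr' ?_
  filter_upwards [Filter.eventually_ge_atTop 1] with n hn
  have hn0 : (n : ℝ) ≠ 0 := by positivity
  simp only [Pi.div_apply, Function.comp]
  push_cast
  by_cases hL : ((lynL q (n + 1)).card : ℝ) = 0
  · simp [hL]
  · field_simp
    try ring

lemma lyn_err (q : ℕ) (hq : 2 ≤ q) :
    Filter.Tendsto (fun n : ℕ => (((q - 1) ^ n : ℕ) : ℝ) / ((lynL q n).card : ℝ))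
      Filter.atTop (nhds 0) := by
  have hq0 : (0 : ℝ) < q := by positivity
  have h := lyn_asymp q hq
  have hr : ((q - 1 : ℕ) : ℝ) / q < 1 := by
    rw [div_lt_one hq0]
    exact_mod_cast (by omega : q - 1 < q)
  have hg := tendsto_self_mul_const_pow_of_lt_one (r := ((q - 1 : ℕ) : ℝ) / q) (by positivity) hr
  have := hg.div h one_ne_zero
  rw [zero_div] at this
  refine this.congr' ?_
  filter_upwards [Filter.eventually_ge_atTop 1] with n hn
  have hn0 : (n : ℝ) ≠ 0 := by positivity
  simp only [Pi.div_apply]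
  by_cases hL : ((lynL q n).card : ℝ) = 0
  · simp [hL]
  · rw [div_pow]
    push_cast
    field_simp

theorem stmt_1 (q : ℕ) (hq : 2 ≤ q) :
    Filter.Tendsto (fun n : ℕ =>
        ((((lyndonWords q n).filter fun w => srfLen (List.ofFn w) = n - 1).card : ℝ)
          / ((lyndonWords q n).card : ℝ)))
      Filter.atTop (nhds (1 / (q : ℝ))) := by
  rw [← Filter.tendsto_add_atTop_iff_nat 1]
  have hr := lyn_ratio q hq
  have he := (lyn_err q hq).comp (Filter.tendsto_add_atTop_nat 1)
  have hu := hr.add he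
  rw [add_zero] at hu
  refine tendsto_of_tendsto_of_tendsto_of_le_of_le' hr hu ?_ ?_
  · filter_upwards [Filter.eventually_ge_atTop 2] with n hn
    rw [lynC_card q (n + 1) (by omega), lynL_card]
    exact div_le_div_of_nonneg_right (by exact_mod_cast lynC_lower q n hq hn) (by positivity)
  · filter_upwards [Filter.eventually_ge_atTop 2] with n hn
    rw [lynC_card q (n + 1) (by omega), lynL_card]
    simp only [Function.comp]
    rw [← add_div]
    gcongr
    exact_mod_cast lynC_upper q n hq
end
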